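/- Let n ≥ 2 and let Ω be a bounded (α, β)-John domain in ℝⁿ. Suppose 0 < δ ≤ n, 0 ≤ κ < 1, and δ/n < p < δ. Then there exists a constant c depending only on n, δ, κ, p, α, and β such that inf_{b ∈ ℝ} ( ∫_Ω |u(x) − b|^{p(δ−κp)/(δ−p)} dH^{δ−κp}_∞ )^{(δ−p)/(p(δ−κp))} ≤ c ( ∫_Ω |∇u(x)|^p dH^δ_∞ )^{1/p} for all u ∈ C¹(Ω). -/

import Mathlib

open MeasureTheory Metric Set Bornology
open scoped ENNReal NNReal

/-- The `δ`-dimensional Hausdorff content of a set `E ⊆ ℝⁿ`, defined as the infimum of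
`∑ᵢ rᵢ^δ` over all countable coverings of `E` by open balls `B(xᵢ, rᵢ)`. -/
noncomputable def hContent (n : ℕ) (δ : ℝ) (E : Set (EuclideanSpace ℝ (Fin n))) : ℝ≥0∞ :=
  ⨅ (x : ℕ → EuclideanSpace ℝ (Fin n)) (r : ℕ → ℝ≥0)
    (_ : E ⊆ ⋃ i, Metric.ball (x i) (r i)), ∑' i, (r i : ℝ≥0∞) ^ δ

/-- The `δ`-dimensional Hausdorff measure of `E ⊆ ℝⁿ`, obtained from coverings by open balls of
radii at most `ρ`, in the limit `ρ → 0⁺` (equivalently: the supremum over `ρ > 0`, since the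
infima increase as `ρ` decreases). -/
noncomputable def hMeasure (n : ℕ) (δ : ℝ) (E : Set (EuclideanSpace ℝ (Fin n))) : ℝ≥0∞ :=
  ⨆ (ρ : ℝ≥0) (_ : 0 < ρ),
    ⨅ (x : ℕ → EuclideanSpace ℝ (Fin n)) (r : ℕ → ℝ≥0)
      (_ : E ⊆ ⋃ i, Metric.ball (x i) (r i)) (_ : ∀ i, r i ≤ ρ), ∑' i, (r i : ℝ≥0∞) ^ δ

/-- The Choquet integral `∫_Ω f dH^δ_∞ = ∫₀^∞ H^δ_∞({x ∈ Ω : f x > t}) dt` of a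
(nonnegative) real-valued function with respect to the Hausdorff content. -/
noncomputable def choquet (n : ℕ) (δ : ℝ) (Ω : Set (EuclideanSpace ℝ (Fin n)))
    (f : EuclideanSpace ℝ (Fin n) → ℝ) : ℝ≥0∞ :=
  ∫⁻ t in Set.Ioi (0 : ℝ), hContent n δ {x ∈ Ω | t < f x}

/-- The Choquet integral of an `[0,∞]`-valued function with respect to the Hausdorff content. -/
noncomputable def echoquet (n : ℕ) (δ : ℝ) (Ω : Set (EuclideanSpace ℝ (Fin n)))
    (f : EuclideanSpace ℝ (Fin n) → ℝ≥0∞) : ℝ≥0∞ :=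
  ∫⁻ t in Set.Ioi (0 : ℝ), hContent n δ {x ∈ Ω | ENNReal.ofReal t < f x}

/-- The centered fractional Hardy–Littlewood maximal function
`M_κ f (x) = sup_{r>0} r^{κ-n} ∫_{B(x,r)} |f|`. -/
noncomputable def fracMaximal (n : ℕ) (κ : ℝ) (f : EuclideanSpace ℝ (Fin n) → ℝ)
    (x : EuclideanSpace ℝ (Fin n)) : ℝ≥0∞ :=
  ⨆ (r : ℝ) (_ : 0 < r),
    ENNReal.ofReal (r ^ (κ - n)) * ∫⁻ y in Metric.ball x r, ENNReal.ofReal |f y|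

/-- The Riesz potential of order `1`: `I₁ f (x) = ∫_{ℝⁿ} |f y| / |x-y|^{n-1} dy`. -/
noncomputable def rieszPot (n : ℕ) (f : EuclideanSpace ℝ (Fin n) → ℝ)
    (x : EuclideanSpace ℝ (Fin n)) : ℝ≥0∞ :=
  ∫⁻ y, ENNReal.ofReal |f y| / edist x y ^ ((n : ℝ) - 1)

/-- `Ω` is an `(α, β)`-John domain with John center `x₀`: every `x ∈ Ω` can be joined to `x₀`
by a rectifiable curve `γ : [0, L] → Ω` parametrized by arclength (hence `1`-Lipschitz) with
`γ 0 = x`, `γ L = x₀`, `L ≤ β` and `dist (γ t, ∂Ω) ≥ (α/β) t`. -/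
def IsJohnDomainWithCenter (n : ℕ) (α β : ℝ) (Ω : Set (EuclideanSpace ℝ (Fin n)))
    (x₀ : EuclideanSpace ℝ (Fin n)) : Prop :=
  x₀ ∈ Ω ∧ ∀ x ∈ Ω, ∃ L : ℝ, 0 ≤ L ∧ L ≤ β ∧ ∃ γ : ℝ → EuclideanSpace ℝ (Fin n),
    γ 0 = x ∧ γ L = x₀ ∧ (∀ t ∈ Set.Icc 0 L, γ t ∈ Ω) ∧
    LipschitzOnWith 1 γ (Set.Icc 0 L) ∧
    ∀ t ∈ Set.Icc 0 L, α / β * t ≤ Metric.infDist (γ t) (frontier Ω)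

/-- `Ω` is an `(α, β)`-John domain. -/
def IsJohnDomain (n : ℕ) (α β : ℝ) (Ω : Set (EuclideanSpace ℝ (Fin n))) : Prop :=
  ∃ x₀, IsJohnDomainWithCenter n α β Ω x₀

lemma hContent_mono {n : ℕ} {δ : ℝ} {A B : Set (EuclideanSpace ℝ (Fin n))} (h : A ⊆ B) :
    hContent n δ A ≤ hContent n δ B := by
  refine le_iInf fun x => le_iInf fun r => le_iInf fun hB => ?_
  exact iInf_le_of_le x (iInf_le_of_le r (iInf_le_of_le (h.trans hB) le_rfl))

lemma hContent_le_tsum_of_cover {n : ℕ} {δ : ℝ} (hδ : 0 < δ) {ι : Type*} [Countable ι]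
    {A : Set (EuclideanSpace ℝ (Fin n))} (x : ι → EuclideanSpace ℝ (Fin n)) (r : ι → ℝ≥0)
    (h : A ⊆ ⋃ i, ball (x i) (r i)) : hContent n δ A ≤ ∑' i, (r i : ℝ≥0∞) ^ δ := by
  obtain ⟨e, he⟩ := exists_injective_nat ι
  have hsum : ∑' j, ((Function.extend e r 0 j : ℝ≥0) : ℝ≥0∞) ^ δ
      = ∑' i, (r i : ℝ≥0∞) ^ δ := by
    rw [← tsum_extend_zero he]
    refine tsum_congr fun j => ?_
    by_cases hj : ∃ i, e i = j
    · obtain ⟨i, rfl⟩ := hj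
      simp [he.extend_apply]
    · simp [Function.extend_apply' _ _ _ hj, hδ]
  rw [← hsum]
  refine iInf_le_of_le (Function.extend e x 0) (iInf_le_of_le (Function.extend e r 0)
    (iInf_le_of_le (fun w hw => ?_) le_rfl))
  obtain ⟨i, hi⟩ := mem_iUnion.1 (h hw)
  refine mem_iUnion.2 ⟨e i, ?_⟩
  simpa [he.extend_apply] using hi

lemma hContent_iUnion_le {n : ℕ} {δ : ℝ} (hδ : 0 < δ) {ι : Type*} [Countable ι]
    (A : ι → Set (EuclideanSpace ℝ (Fin n))) :
    hContent n δ (⋃ i, A i) ≤ ∑' i, hContent n δ (A i) := by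
  refine ENNReal.le_of_forall_pos_le_add fun ε hε hfin => ?_
  obtain ⟨ε', hε', hsum⟩ := ENNReal.exists_pos_sum_of_countable (ε := (ε : ℝ≥0∞))
    (by simpa using hε.ne') ι
  have hlt : ∀ i, hContent n δ (A i) < hContent n δ (A i) + ε' i := fun i =>
    ENNReal.lt_add_right (ENNReal.ne_top_of_tsum_ne_top hfin.ne i) (by simpa using (hε' i).ne')
  have hex : ∀ i, ∃ (x : ℕ → EuclideanSpace ℝ (Fin n)) (r : ℕ → ℝ≥0),
      A i ⊆ (⋃ j, ball (x j) (r j)) ∧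
        ∑' j, (r j : ℝ≥0∞) ^ δ < hContent n δ (A i) + ε' i := by
    intro i
    have := hlt i
    conv_lhs at this => unfold hContent
    simpa only [iInf_lt_iff, exists_prop] using this
  choose x r hcov hr using hex
  calc hContent n δ (⋃ i, A i)
      ≤ ∑' ij : ι × ℕ, (r ij.1 ij.2 : ℝ≥0∞) ^ δ := by
        refine hContent_le_tsum_of_cover hδ (fun ij : ι × ℕ => x ij.1 ij.2)
          (fun ij => r ij.1 ij.2) fun w hw => ?_
        obtain ⟨i, hi⟩ := mem_iUnion.1 hw
        obtain ⟨j, hj⟩ := mem_iUnion.1 (hcov i hi)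
        exact mem_iUnion.2 ⟨(i, j), hj⟩
    _ = ∑' i, ∑' j, (r i j : ℝ≥0∞) ^ δ :=
        ENNReal.tsum_prod (f := fun i j => (r i j : ℝ≥0∞) ^ δ)
    _ ≤ ∑' i, (hContent n δ (A i) + ε' i) := ENNReal.tsum_le_tsum fun i => (hr i).le
    _ = ∑' i, hContent n δ (A i) + ∑' i, (ε' i : ℝ≥0∞) := ENNReal.tsum_add
    _ ≤ _ := by gcongr

/-- The index of the half-open dyadic cube of side `2 ^ m` that contains `y`. -/
noncomputable def dyadicIndex {n : ℕ} (m : ℤ) (y : EuclideanSpace ℝ (Fin n)) : Fin n → ℤ :=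
  fun i => ⌊y i / (2 : ℝ) ^ m⌋

/-- The corner of the dyadic cube of side `2 ^ m` with index `z`. -/
noncomputable def dyadicCorner {n : ℕ} (m : ℤ) (z : Fin n → ℤ) : EuclideanSpace ℝ (Fin n) :=
  WithLp.toLp 2 fun i => (z i : ℝ) * (2 : ℝ) ^ m

lemma dyadicIndex_corner {n : ℕ} (m : ℤ) (z : Fin n → ℤ) :
    dyadicIndex m (dyadicCorner m z) = z := by
  funext i
  have : (2 : ℝ) ^ m ≠ 0 := by positivity
  simp [dyadicIndex, dyadicCorner, this]

lemma dyadicIndex_mono {n : ℕ} {m m' : ℤ} (h : m ≤ m') {y w : EuclideanSpace ℝ (Fin n)}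
    (hyw : dyadicIndex m y = dyadicIndex m w) : dyadicIndex m' y = dyadicIndex m' w := by
  obtain ⟨l, rfl⟩ := Int.le.dest h
  have key : ∀ v : EuclideanSpace ℝ (Fin n),
      dyadicIndex (m + l) v = fun i => dyadicIndex m v i / (((2 ^ l : ℕ)) : ℤ) := by
    intro v
    funext i
    simp only [dyadicIndex]
    rw [← Int.floor_div_natCast, zpow_add₀ two_ne_zero, ← div_div]
    simp
  rw [key, key, hyw]

lemma norm_sub_le_of_dyadicIndex_eq {n : ℕ} {m : ℤ} {y w : EuclideanSpace ℝ (Fin n)}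
    (hyw : dyadicIndex m y = dyadicIndex m w) : dist y w ≤ √n * (2 : ℝ) ^ m := by
  have hL : (0 : ℝ) < (2 : ℝ) ^ m := by positivity
  rw [EuclideanSpace.dist_eq]
  refine Real.sqrt_le_iff.2 ⟨by positivity, ?_⟩
  rw [mul_pow, Real.sq_sqrt (by positivity)]
  calc ∑ i, dist (y i) (w i) ^ 2 ≤ ∑ _i : Fin n, ((2 : ℝ) ^ m) ^ 2 := by
        refine Finset.sum_le_sum fun i _ => ?_
        have h := congrFun hyw i
        simp only [dyadicIndex] at h
        have h1 := Int.abs_sub_lt_one_of_floor_eq_floor h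
        rw [← sub_div, abs_div, abs_of_pos hL, div_lt_one hL] at h1
        rw [Real.dist_eq]
        gcongr
    _ = _ := by simp

lemma ofReal_two_zpow (m : ℤ) : ENNReal.ofReal ((2 : ℝ) ^ m) = (2 : ℝ≥0∞) ^ (m : ℝ) := by
  rw [← Real.rpow_intCast, ← ENNReal.ofReal_rpow_of_pos two_pos]
  simp

lemma two_rpow_ne_zero (t : ℝ) : (2 : ℝ≥0∞) ^ t ≠ 0 := by
  simp [ENNReal.rpow_eq_zero_iff]

lemma two_rpow_ne_top (t : ℝ) : (2 : ℝ≥0∞) ^ t ≠ ⊤ := by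
  simp [ENNReal.rpow_eq_top_iff]

lemma two_rpow_add (s t : ℝ) : (2 : ℝ≥0∞) ^ (s + t) = 2 ^ s * 2 ^ t :=
  ENNReal.rpow_add s t two_ne_zero ENNReal.ofNat_ne_top

lemma volume_dyadicCube_le {n : ℕ} (m : ℤ) (z : Fin n → ℤ) :
    volume {w : EuclideanSpace ℝ (Fin n) | dyadicIndex m w = z} ≤ 2 ^ ((m : ℝ) * n) := by
  have hL : (0 : ℝ) < (2 : ℝ) ^ m := by positivity
  have hpre : {w : EuclideanSpace ℝ (Fin n) | dyadicIndex m w = z} ⊆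
      (MeasurableEquiv.toLp 2 (Fin n → ℝ)).symm ⁻¹'
        (Set.pi univ fun i => Ico ((z i : ℝ) * 2 ^ m) (((z i : ℝ) + 1) * 2 ^ m)) := by
    intro w hw i _
    have h := congrFun hw i
    simp only [dyadicIndex] at h
    rw [Int.floor_eq_iff, le_div_iff₀ hL, div_lt_iff₀ hL] at h
    exact h
  refine (measure_mono hpre).trans ?_
  rw [(EuclideanSpace.volume_preserving_symm_measurableEquiv_toLp (Fin n)).measure_preimage
    (MeasurableSet.univ_pi fun i => measurableSet_Ico).nullMeasurableSet, Real.volume_pi_Ico]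
  have : ∀ i, ((z i : ℝ) + 1) * 2 ^ m - (z i : ℝ) * 2 ^ m = 2 ^ m := fun i => by ring
  simp only [this, Finset.prod_const, Finset.card_univ, Fintype.card_fin, ofReal_two_zpow]
  rw [← ENNReal.rpow_natCast, ← ENNReal.rpow_mul]

/-- The proportion of the dyadic cube of side `2 ^ m` around `y` occupied by `A`. -/
noncomputable def dyadicDensity {n : ℕ} (A : Set (EuclideanSpace ℝ (Fin n))) (m : ℤ)
    (y : EuclideanSpace ℝ (Fin n)) : ℝ≥0∞ :=
  volume (A ∩ {w | dyadicIndex m w = dyadicIndex m y}) / 2 ^ ((m : ℝ) * n)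

lemma dyadicDensity_le_one {n : ℕ} (A : Set (EuclideanSpace ℝ (Fin n))) (m : ℤ)
    (y : EuclideanSpace ℝ (Fin n)) : dyadicDensity A m y ≤ 1 := by
  refine ENNReal.div_le_of_le_mul ?_
  rw [one_mul]
  exact (measure_mono inter_subset_right).trans (volume_dyadicCube_le _ _)

lemma ENNReal.tsum_rpow_le {ι : Type*} (c : ι → ℝ≥0∞) {t : ℝ} (ht : 1 ≤ t) :
    ∑' i, c i ^ t ≤ (∑' i, c i) ^ t := by
  have hsplit : ∀ x : ℝ≥0∞, x ^ t = x * x ^ (t - 1) := fun x => by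
    conv_lhs => rw [← add_sub_cancel 1 t]
    rw [ENNReal.rpow_add_of_nonneg _ _ zero_le_one (by linarith), ENNReal.rpow_one]
  calc ∑' i, c i ^ t ≤ ∑' i, c i * (∑' i, c i) ^ (t - 1) := by
        refine ENNReal.tsum_le_tsum fun i => ?_
        rw [hsplit]
        gcongr
        exact ENNReal.le_tsum i
    _ = _ := by rw [ENNReal.tsum_mul_right, ← hsplit]

/-- Every set is covered by countably many dyadic cubes whose `δ`-sum is comparable with that of
a given covering by balls. -/
lemma exists_dyadic_cover {n : ℕ} {δ : ℝ} (hδ : 0 < δ) {A : Set (EuclideanSpace ℝ (Fin n))}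
    (x : ℕ → EuclideanSpace ℝ (Fin n)) (r : ℕ → ℝ≥0) (h : A ⊆ ⋃ i, ball (x i) (r i)) :
    ∃ (ι : Type) (_ : Countable ι) (y : ι → EuclideanSpace ℝ (Fin n)) (k : ι → ℤ),
      (∀ w ∈ A, ∃ i, dyadicIndex (k i) w = dyadicIndex (k i) (y i)) ∧
      ∑' i, (2 : ℝ≥0∞) ^ ((k i : ℝ) * δ) ≤ (2 ^ n * 4 ^ δ) * ∑' i, (r i : ℝ≥0∞) ^ δ := by
  have hk : ∀ j : {j // 0 < r j}, ∃ k : ℤ, 2 * (r j : ℝ) ≤ 2 ^ k ∧ (2 : ℝ) ^ k ≤ 4 * r j := by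
    intro j
    have hj : (0 : ℝ) < r j := j.2
    obtain ⟨k, h1, h2⟩ := exists_mem_Ico_zpow (x := 2 * (r j : ℝ)) (y := (2 : ℝ))
      (by positivity) one_lt_two
    rw [zpow_add_one₀ two_ne_zero] at h2
    refine ⟨k + 1, ?_, ?_⟩ <;> rw [zpow_add_one₀ two_ne_zero] <;> linarith
  choose k hk1 hk2 using hk
  refine ⟨{j // 0 < r j} × (Fin n → Bool), inferInstance,
    fun a => WithLp.toLp 2 fun i => x a.1 i + (if a.2 i then (r a.1 : ℝ) else -(r a.1 : ℝ)),
    fun a => k a.1, ?_, ?_⟩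
  · intro w hw
    obtain ⟨j, hj⟩ := mem_iUnion.1 (h hw)
    rw [mem_ball] at hj
    have hr : 0 < r j := by
      have : (0 : ℝ) < r j := dist_nonneg.trans_lt hj
      exact_mod_cast this
    have hL : (0 : ℝ) < 2 ^ k ⟨j, hr⟩ := by positivity
    have hc : ∀ i, ∃ b : Bool, ⌊w i / (2 : ℝ) ^ k ⟨j, hr⟩⌋
        = ⌊(x j i + (if b then (r j : ℝ) else -(r j : ℝ))) / (2 : ℝ) ^ k ⟨j, hr⟩⌋ := by
      intro i
      have hwi : |w i - x j i| < r j := by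
        refine lt_of_le_of_lt ?_ hj
        rw [dist_eq_norm]
        exact PiLp.norm_apply_le (w - x j) i
      rw [abs_lt] at hwi
      have e1 : ⌊(x j i - r j) / (2 : ℝ) ^ k ⟨j, hr⟩⌋ ≤ ⌊w i / (2 : ℝ) ^ k ⟨j, hr⟩⌋ := by
        gcongr; linarith
      have e2 : ⌊w i / (2 : ℝ) ^ k ⟨j, hr⟩⌋ ≤ ⌊(x j i + r j) / (2 : ℝ) ^ k ⟨j, hr⟩⌋ := by
        gcongr; linarith
      have e3 : ⌊(x j i + r j) / (2 : ℝ) ^ k ⟨j, hr⟩⌋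
          ≤ ⌊(x j i - r j) / (2 : ℝ) ^ k ⟨j, hr⟩⌋ + 1 := by
        rw [← Int.floor_add_one]
        apply Int.floor_le_floor
        rw [div_add_one hL.ne']
        have := hk1 ⟨j, hr⟩
        dsimp at this
        exact div_le_div_of_nonneg_right (by linarith) hL.le
      by_cases hh : ⌊w i / (2 : ℝ) ^ k ⟨j, hr⟩⌋ = ⌊(x j i - r j) / (2 : ℝ) ^ k ⟨j, hr⟩⌋
      · exact ⟨false, by simpa [sub_eq_add_neg] using hh⟩
      · exact ⟨true, by simp only [if_true]; omega⟩
    choose b hb using hc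
    exact ⟨(⟨j, hr⟩, b), funext fun i => by simpa [dyadicIndex] using hb i⟩
  · rw [ENNReal.tsum_prod (f := fun (j : {j // 0 < r j}) (_ : Fin n → Bool) =>
      (2 : ℝ≥0∞) ^ ((k j : ℝ) * δ))]
    simp only [ENNReal.tsum_const, ENat.card_eq_coe_fintype_card, Fintype.card_pi,
      Fintype.card_bool, Finset.prod_const, Finset.card_univ, Fintype.card_fin]
    rw [ENNReal.tsum_mul_left, mul_assoc, ← ENNReal.tsum_mul_left (a := (4 : ℝ≥0∞) ^ δ)]
    push_cast
    gcongr
    calc ∑' j : {j // 0 < r j}, (2 : ℝ≥0∞) ^ ((k j : ℝ) * δ)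
        ≤ ∑' j : {j // 0 < r j}, (4 : ℝ≥0∞) ^ δ * (r j : ℝ≥0∞) ^ δ := by
          refine ENNReal.tsum_le_tsum fun j => ?_
          rw [ENNReal.rpow_mul, ← ofReal_two_zpow, ← ENNReal.mul_rpow_of_nonneg _ _ hδ.le]
          gcongr
          refine (ENNReal.ofReal_le_ofReal (hk2 j)).trans ?_
          rw [ENNReal.ofReal_mul (by norm_num)]
          simp
      _ ≤ _ := ENNReal.tsum_comp_le_tsum_of_injective Subtype.val_injective
          (fun j => (4 : ℝ≥0∞) ^ δ * (r j : ℝ≥0∞) ^ δ)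

/-- The set of points close to a dyadic cube, of side `2 ^ m`, in which the density of `A` raised
to the power `s` exceeds `N * 2 ^ (-m * e)`. -/
def denseSet {n : ℕ} (e s : ℝ) (A : Set (EuclideanSpace ℝ (Fin n))) (N : ℝ≥0∞) :
    Set (EuclideanSpace ℝ (Fin n)) :=
  {x | ∃ (m : ℤ) (y : EuclideanSpace ℝ (Fin n)), dist x y ≤ (2 : ℝ) ^ m ∧
    N < 2 ^ ((m : ℝ) * e) * dyadicDensity A m y ^ s}

lemma denseSet_anti {n : ℕ} (e s : ℝ) (A : Set (EuclideanSpace ℝ (Fin n))) :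
    Antitone (denseSet e s A) := by
  rintro N N' h x ⟨m, y, hxy, hN⟩
  exact ⟨m, y, hxy, h.trans_lt hN⟩

/-- The total `δ`-mass of those cubes of a family that lie in the dyadic cube of side `2 ^ m`
around `v`. -/
noncomputable def cubeMass {n : ℕ} {ι : Type} (δ : ℝ) (y : ι → EuclideanSpace ℝ (Fin n))
    (k : ι → ℤ) (m : ℤ) (v : EuclideanSpace ℝ (Fin n)) : ℝ≥0∞ :=
  open Classical in
  ∑' i, if k i ≤ m ∧ dyadicIndex m (y i) = dyadicIndex m v then 2 ^ ((k i : ℝ) * δ) else 0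

/-- The truncated `δ`-density of a family of cubes, raised to the power `a` and weighted by the
power `e` of the side. -/
noncomputable def cubeScore {n : ℕ} {ι : Type} (δ e a : ℝ) (y : ι → EuclideanSpace ℝ (Fin n))
    (k : ι → ℤ) (m : ℤ) (v : EuclideanSpace ℝ (Fin n)) : ℝ≥0∞ :=
  2 ^ ((m : ℝ) * e) * min 1 (cubeMass δ y k m v / 2 ^ ((m : ℝ) * δ)) ^ a

section Score

variable {n : ℕ} {ι : Type} {δ e s a : ℝ} (y : ι → EuclideanSpace ℝ (Fin n)) (k : ι → ℤ)

lemma cubeScore_congr {m : ℤ} {v w : EuclideanSpace ℝ (Fin n)}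
    (h : dyadicIndex m v = dyadicIndex m w) :
    cubeScore δ e a y k m v = cubeScore δ e a y k m w := by
  simp only [cubeScore, cubeMass, h]

lemma cubeScore_le (ha : 0 ≤ a) (m : ℤ) (v : EuclideanSpace ℝ (Fin n)) :
    cubeScore δ e a y k m v ≤ 2 ^ ((m : ℝ) * e) := by
  unfold cubeScore
  refine mul_le_of_le_one_right' (ENNReal.rpow_le_one (min_le_left _ _) ha)

lemma cubeMass_le (m : ℤ) (v : EuclideanSpace ℝ (Fin n)) :
    cubeMass δ y k m v ≤ ∑' i, (2 : ℝ≥0∞) ^ ((k i : ℝ) * δ) := by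
  refine ENNReal.tsum_le_tsum fun i => ?_
  split_ifs
  · exact le_rfl
  · exact zero_le

lemma exists_le_cubeScore [Countable ι] (hδ : 0 < δ) (hδn : δ ≤ n) (he : 0 ≤ e) (hs : 0 < s)
    {A : Set (EuclideanSpace ℝ (Fin n))}
    (hcov : ∀ w ∈ A, ∃ i, dyadicIndex (k i) w = dyadicIndex (k i) (y i))
    (m : ℤ) (v : EuclideanSpace ℝ (Fin n)) :
    ∃ m', m ≤ m' ∧ 2 ^ ((m : ℝ) * e) * dyadicDensity A m v ^ s
      ≤ cubeScore δ e (s * n / δ) y k m' v := by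
  classical
  by_cases h : ∃ i, m < k i ∧ dyadicIndex (k i) (y i) = dyadicIndex (k i) v
  · obtain ⟨i, hi, hiv⟩ := h
    refine ⟨k i, hi.le, ?_⟩
    have hmass : (2 : ℝ≥0∞) ^ ((k i : ℝ) * δ) ≤ cubeMass δ y k (k i) v := by
      refine le_trans ?_ (ENNReal.le_tsum i)
      simp [hiv]
    have hone : 1 ≤ cubeMass δ y k (k i) v / 2 ^ ((k i : ℝ) * δ) := by
      rwa [ENNReal.le_div_iff_mul_le (Or.inl (two_rpow_ne_zero _)) (Or.inl (two_rpow_ne_top _)),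
        one_mul]
    rw [cubeScore, min_eq_left hone, ENNReal.one_rpow]
    refine mul_le_mul' (ENNReal.rpow_le_rpow_of_exponent_le one_le_two ?_)
      (ENNReal.rpow_le_one (dyadicDensity_le_one _ _ _) hs.le)
    have : (m : ℝ) ≤ k i := by exact_mod_cast hi.le
    gcongr
  · push Not at h
    refine ⟨m, le_rfl, ?_⟩
    have hn : 1 ≤ n / δ := by rwa [le_div_iff₀ hδ, one_mul]
    have hvol : volume (A ∩ {w | dyadicIndex m w = dyadicIndex m v})
        ≤ cubeMass δ y k m v ^ (n / δ) := by
      have hsub : A ∩ {w | dyadicIndex m w = dyadicIndex m v} ⊆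
          ⋃ i, (if k i ≤ m ∧ dyadicIndex m (y i) = dyadicIndex m v then
            {w | dyadicIndex (k i) w = dyadicIndex (k i) (y i)} else ∅) := by
        rintro w ⟨hwA, hwv⟩
        obtain ⟨i, hi⟩ := hcov w hwA
        have hkm : k i ≤ m := by
          by_contra! hlt
          exact h i hlt (hi.symm.trans (dyadicIndex_mono hlt.le hwv))
        refine mem_iUnion.2 ⟨i, ?_⟩
        rw [if_pos ⟨hkm, (dyadicIndex_mono hkm hi).symm.trans hwv⟩]
        exact hi
      calc _ ≤ _ := measure_mono hsub
        _ ≤ _ := measure_iUnion_le _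
        _ ≤ ∑' i, (if k i ≤ m ∧ dyadicIndex m (y i) = dyadicIndex m v then
            (2 : ℝ≥0∞) ^ ((k i : ℝ) * δ) else 0) ^ ((n : ℝ) / δ) := by
          refine ENNReal.tsum_le_tsum fun i => ?_
          split_ifs
          · rw [← ENNReal.rpow_mul]
            have : (k i : ℝ) * δ * (n / δ) = (k i : ℝ) * n := by field_simp
            rw [this]
            exact volume_dyadicCube_le _ _
          · simp
        _ ≤ _ := ENNReal.tsum_rpow_le _ hn
    have hdens : dyadicDensity A m v
        ≤ min 1 (cubeMass δ y k m v / 2 ^ ((m : ℝ) * δ)) ^ ((n : ℝ) / δ) := by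
      rcases min_cases 1 (cubeMass δ y k m v / 2 ^ ((m : ℝ) * δ)) with h1 | h1
      · rw [h1.1, ENNReal.one_rpow]
        exact dyadicDensity_le_one _ _ _
      · rw [h1.1, ENNReal.div_rpow_of_nonneg _ _ (by linarith), ← ENNReal.rpow_mul]
        have : (m : ℝ) * δ * (n / δ) = (m : ℝ) * n := by field_simp
        rw [this]
        exact ENNReal.div_le_div_right hvol _
    unfold cubeScore
    have : s * n / δ = n / δ * s := by ring
    rw [this, ENNReal.rpow_mul _ ((n : ℝ) / δ) s]
    gcongr

lemma exists_forall_cubeScore_le (hδ : 0 < δ) (heδ : e < δ) (ha : 1 ≤ a)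
    (hfin : ∑' i, (2 : ℝ≥0∞) ^ ((k i : ℝ) * δ) ≠ ⊤) {N : ℝ≥0∞} (hN : 0 < N) :
    ∃ M : ℤ, ∀ m, M ≤ m → ∀ v, cubeScore δ e a y k m v ≤ N := by
  set V := ∑' i, (2 : ℝ≥0∞) ^ ((k i : ℝ) * δ)
  set η := δ * a - e
  have hη : 0 < η := by
    have : δ * 1 ≤ δ * a := by gcongr
    simp only [η]; linarith
  have hbound : ∀ m v, cubeScore δ e a y k m v ≤ V ^ a * 2 ^ (-((m : ℝ) * η)) := by
    intro m v
    have h1 : min 1 (cubeMass δ y k m v / 2 ^ ((m : ℝ) * δ)) ^ a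
        ≤ V ^ a * 2 ^ (-((m : ℝ) * δ * a)) := by
      calc _ ≤ (V / 2 ^ ((m : ℝ) * δ)) ^ a := by
            gcongr
            exact (min_le_right _ _).trans (ENNReal.div_le_div_right (cubeMass_le y k m v) _)
        _ = _ := by
            rw [ENNReal.div_rpow_of_nonneg _ _ (by linarith), ← ENNReal.rpow_mul, div_eq_mul_inv,
              ← ENNReal.rpow_neg]
    calc _ ≤ 2 ^ ((m : ℝ) * e) * (V ^ a * 2 ^ (-((m : ℝ) * δ * a))) := by
          unfold cubeScore; gcongr
      _ = V ^ a * (2 ^ ((m : ℝ) * e) * 2 ^ (-((m : ℝ) * δ * a))) := by ring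
      _ = _ := by
          rw [← two_rpow_add]
          congr 2
          simp only [η]; ring
  have hVa : V ^ a ≠ ⊤ := ENNReal.rpow_ne_top_of_nonneg (by linarith) hfin
  have hq : (2 : ℝ≥0∞) ^ (-η) < 1 :=
    ENNReal.rpow_lt_one_of_one_lt_of_neg ENNReal.one_lt_two (by linarith)
  have htend := ENNReal.Tendsto.const_mul (a := V ^ a)
    (ENNReal.tendsto_pow_atTop_nhds_zero_of_lt_one hq) (Or.inr hVa)
  rw [mul_zero] at htend
  obtain ⟨M, hM⟩ := ((tendsto_order.1 htend).2 N hN).exists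
  refine ⟨M, fun m hm v => (hbound m v).trans (le_trans ?_ hM.le)⟩
  rw [← ENNReal.rpow_natCast, ← ENNReal.rpow_mul]
  gcongr
  · exact one_le_two
  · have : (M : ℝ) ≤ m := by exact_mod_cast hm
    nlinarith

end Score

lemma lintegral_truncated_power_le {ε : ℝ} (hε0 : 0 < ε) (T : ℝ≥0∞) :
    ∫⁻ N in Ioi (0 : ℝ), (if ENNReal.ofReal N < T then
      ENNReal.ofReal N ^ (ε - 1) * T ^ (-ε) else 0) ≤ ENNReal.ofReal (1 / ε) := by
  induction T with
  | top =>
    refine le_trans (lintegral_mono fun N => (?_ : _ ≤ (0 : ℝ≥0∞))) (by simp)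
    simp [ENNReal.top_rpow_of_neg (neg_lt_zero.2 hε0)]
  | coe τ =>
    rcases eq_or_ne τ 0 with rfl | hτ
    · simp
    have hτ0 : (0 : ℝ) < τ := by positivity
    have hτo : (τ : ℝ≥0∞) = ENNReal.ofReal τ := by simp
    have hint : IntervalIntegrable (fun x : ℝ => x ^ (ε - 1)) volume 0 τ :=
      intervalIntegral.intervalIntegrable_rpow' (by linarith)
    have hcalc : ∫⁻ N in Ioc (0 : ℝ) τ, ENNReal.ofReal (N ^ (ε - 1))
        = ENNReal.ofReal (τ ^ ε / ε) := by
      rw [← ofReal_integral_eq_lintegral_ofReal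
        ((intervalIntegrable_iff_integrableOn_Ioc_of_le hτ0.le).1 hint)]
      · rw [← intervalIntegral.integral_of_le hτ0.le, integral_rpow (Or.inl (by linarith))]
        simp [hε0.ne']
      · filter_upwards [ae_restrict_mem measurableSet_Ioc] with N hN
        exact Real.rpow_nonneg hN.1.le _
    calc _ ≤ ∫⁻ N in Ioi (0 : ℝ), (Ioc (0 : ℝ) τ).indicator
          (fun N => ENNReal.ofReal (N ^ (ε - 1)) * (τ : ℝ≥0∞) ^ (-ε)) N := by
          refine setLIntegral_mono' measurableSet_Ioi fun N hN => ?_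
          split_ifs with h
          · rw [hτo, ENNReal.ofReal_lt_ofReal_iff hτ0] at h
            rw [indicator_of_mem (show N ∈ Ioc (0 : ℝ) τ from ⟨hN, h.le⟩),
              ENNReal.ofReal_rpow_of_pos hN]
          · exact zero_le
      _ ≤ ∫⁻ N in Ioc (0 : ℝ) τ, ENNReal.ofReal (N ^ (ε - 1)) * (τ : ℝ≥0∞) ^ (-ε) := by
          rw [← lintegral_indicator measurableSet_Ioc]
          exact setLIntegral_le_lintegral _ _
      _ = _ := by
          rw [lintegral_mul_const' _ _ (by simp [ENNReal.rpow_eq_top_iff, hτ]), hcalc, hτo,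
            ENNReal.ofReal_rpow_of_pos hτ0, ← ENNReal.ofReal_mul (by positivity)]
          congr 1
          rw [Real.rpow_neg hτ0.le]
          have := (Real.rpow_pos_of_pos hτ0 ε).ne'
          field_simp

lemma side_rpow_le_of_lt_score {δ e a : ℝ} (ha : 1 < a) (m : ℤ) {ν N T : ℝ≥0∞}
    (hN0 : N ≠ 0) (hNt : N ≠ ⊤)
    (hN : N ≤ 2 ^ ((m : ℝ) * e) * (ν / 2 ^ ((m : ℝ) * δ)) ^ a) (hT : T ≤ 2 ^ ((m : ℝ) * e)) :
    (2 : ℝ≥0∞) ^ ((m : ℝ) * (δ - e)) ≤ ν * (N ^ ((1 - 1 / a) - 1) * T ^ (-(1 - 1 / a))) := by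
  have ha0 : 0 < a := by linarith
  have hε : 0 ≤ 1 - 1 / a := by
    rw [sub_nonneg, div_le_one ha0]; exact ha.le
  have h1 : N ^ (1 / a) * 2 ^ ((m : ℝ) * δ) ≤ 2 ^ ((m : ℝ) * e * (1 / a)) * ν := by
    have := ENNReal.rpow_le_rpow hN (show 0 ≤ 1 / a by positivity)
    rw [ENNReal.mul_rpow_of_nonneg _ _ (by positivity), ← ENNReal.rpow_mul, ← ENNReal.rpow_mul,
      mul_one_div_cancel ha0.ne', ENNReal.rpow_one, ← mul_div_assoc] at this
    rwa [ENNReal.le_div_iff_mul_le (Or.inl (two_rpow_ne_zero _)) (Or.inl (two_rpow_ne_top _))]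
      at this
  have h2 : (2 : ℝ≥0∞) ^ (-((m : ℝ) * e * (1 - 1 / a))) ≤ T ^ (-(1 - 1 / a)) := by
    rw [ENNReal.rpow_neg, ENNReal.rpow_neg, ENNReal.inv_le_inv, ENNReal.rpow_mul]
    exact ENNReal.rpow_le_rpow hT hε
  calc (2 : ℝ≥0∞) ^ ((m : ℝ) * (δ - e))
      = N ^ (-(1 / a)) * (N ^ (1 / a) * 2 ^ ((m : ℝ) * δ)) * 2 ^ (-((m : ℝ) * e)) := by
        rw [← mul_assoc, ← ENNReal.rpow_add _ _ hN0 hNt, neg_add_cancel, ENNReal.rpow_zero,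
          one_mul, ← two_rpow_add]
        congr 1; ring
    _ ≤ N ^ (-(1 / a)) * (2 ^ ((m : ℝ) * e * (1 / a)) * ν) * 2 ^ (-((m : ℝ) * e)) := by gcongr
    _ = ν * (N ^ (-(1 / a)) * (2 ^ ((m : ℝ) * e * (1 / a)) * 2 ^ (-((m : ℝ) * e)))) := by ring
    _ = ν * (N ^ ((1 - 1 / a) - 1) * 2 ^ (-((m : ℝ) * e * (1 - 1 / a)))) := by
        rw [← two_rpow_add]
        congr 3 <;> ring
    _ ≤ _ := by gcongr

section Maximal

variable {n : ℕ} {ι : Type} {δ e a : ℝ} (y : ι → EuclideanSpace ℝ (Fin n)) (k : ι → ℤ)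

/-- The dyadic cubes that are maximal among those with score greater than `N`. -/
def IsMaximalCube (δ e a : ℝ) (N : ℝ≥0∞) (P : ℤ × (Fin n → ℤ)) : Prop :=
  N < cubeScore δ e a y k P.1 (dyadicCorner P.1 P.2) ∧
    ∀ m', P.1 < m' → cubeScore δ e a y k m' (dyadicCorner P.1 P.2) ≤ N

variable {y k}

lemma IsMaximalCube.eq_of_mem {N : ℝ≥0∞} {P Q : ℤ × (Fin n → ℤ)} {v : EuclideanSpace ℝ (Fin n)}
    (hP : IsMaximalCube y k δ e a N P) (hQ : IsMaximalCube y k δ e a N Q)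
    (hvP : dyadicIndex P.1 v = P.2) (hvQ : dyadicIndex Q.1 v = Q.2) : P = Q := by
  have key : ∀ {P Q : ℤ × (Fin n → ℤ)}, IsMaximalCube y k δ e a N P →
      IsMaximalCube y k δ e a N Q → dyadicIndex P.1 v = P.2 → dyadicIndex Q.1 v = Q.2 →
      ¬ P.1 < Q.1 := by
    intro P Q hP hQ hvP hvQ hlt
    have h1 := hP.2 _ hlt
    have h2 : dyadicIndex Q.1 (dyadicCorner P.1 P.2) = dyadicIndex Q.1 (dyadicCorner Q.1 Q.2) := by
      rw [dyadicIndex_corner, ← hvQ]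
      exact dyadicIndex_mono hlt.le (by rw [dyadicIndex_corner, hvP])
    rw [cubeScore_congr y k h2] at h1
    exact absurd hQ.1 h1.not_gt
  have h1 : P.1 = Q.1 := le_antisymm (not_lt.1 (key hQ hP hvQ hvP)) (not_lt.1 (key hP hQ hvP hvQ))
  exact Prod.ext h1 (by rw [← hvP, ← hvQ, h1])

lemma exists_isMaximalCube (hδ : 0 < δ) (heδ : e < δ) (ha : 1 ≤ a)
    (hfin : ∑' i, (2 : ℝ≥0∞) ^ ((k i : ℝ) * δ) ≠ ⊤) {N : ℝ≥0∞} (hN : 0 < N) {m : ℤ}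
    {v : EuclideanSpace ℝ (Fin n)} (h : N < cubeScore δ e a y k m v) :
    ∃ m', m ≤ m' ∧ IsMaximalCube y k δ e a N (m', dyadicIndex m' v) := by
  obtain ⟨M, hM⟩ := exists_forall_cubeScore_le y k hδ heδ ha hfin hN
  obtain ⟨m', h1, h2⟩ := Int.exists_greatest_of_bdd (P := fun m => N < cubeScore δ e a y k m v)
    ⟨M, fun z hz => by
      by_contra! hlt
      exact absurd hz (hM z hlt.le v).not_gt⟩ ⟨m, h⟩
  refine ⟨m', h2 m h, ?_, ?_⟩
  · rwa [cubeScore_congr y k (dyadicIndex_corner m' (dyadicIndex m' v))]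
  · intro m'' hm
    rw [cubeScore_congr y k
      (dyadicIndex_mono hm.le (dyadicIndex_corner m' (dyadicIndex m' v)))]
    by_contra! hlt
    exact absurd (h2 m'' hlt) (not_le.2 hm)

lemma IsMaximalCube.iSup_score_le (he : 0 ≤ e) (ha : 0 ≤ a) {N : ℝ≥0∞} {P : ℤ × (Fin n → ℤ)}
    (hP : IsMaximalCube y k δ e a N P) {v : EuclideanSpace ℝ (Fin n)}
    (hv : dyadicIndex P.1 v = P.2) :
    ⨆ m, cubeScore δ e a y k m v ≤ 2 ^ ((P.1 : ℝ) * e) := by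
  refine iSup_le fun m => ?_
  have hv' : dyadicIndex P.1 v = dyadicIndex P.1 (dyadicCorner P.1 P.2) := by
    rw [dyadicIndex_corner, hv]
  rcases le_or_gt m P.1 with h | h
  · refine (cubeScore_le y k ha m v).trans (ENNReal.rpow_le_rpow_of_exponent_le one_le_two ?_)
    have : (m : ℝ) ≤ P.1 := by exact_mod_cast h
    gcongr
  · rw [cubeScore_congr y k (dyadicIndex_mono h.le hv')]
    exact ((hP.2 m h).trans hP.1.le).trans (cubeScore_le y k ha _ _)

end Maximal

/-- The bound for the level sets of the fractional maximal function of a set, in terms of a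
covering by dyadic cubes. -/
lemma hContent_denseSet_le {n : ℕ} {ι : Type} [Countable ι] {δ e s : ℝ} (hδ : 0 < δ)
    (hδn : δ ≤ n) (he : 0 ≤ e) (heδ : e < δ) (hs : δ / n < s)
    {y : ι → EuclideanSpace ℝ (Fin n)} {k : ι → ℤ} {A : Set (EuclideanSpace ℝ (Fin n))}
    (hcov : ∀ w ∈ A, ∃ i, dyadicIndex (k i) w = dyadicIndex (k i) (y i))
    (hfin : ∑' i, (2 : ℝ≥0∞) ^ ((k i : ℝ) * δ) ≠ ⊤) {N : ℝ≥0∞} (hN0 : N ≠ 0) (hNt : N ≠ ⊤) :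
    hContent n (δ - e) (denseSet e s A N) ≤ ENNReal.ofReal (2 + √n) ^ (δ - e) *
      ∑' i, 2 ^ ((k i : ℝ) * δ) *
        (if N < ⨆ m, cubeScore δ e (s * n / δ) y k m (y i) then
          N ^ ((1 - 1 / (s * n / δ)) - 1) *
            (⨆ m, cubeScore δ e (s * n / δ) y k m (y i)) ^ (-(1 - 1 / (s * n / δ))) else 0) := by
  classical
  set a := s * n / δ with ha_def
  have hn : (0 : ℝ) < n := hδ.trans_le hδn
  have ha : 1 < a := by
    rw [ha_def, lt_div_iff₀ hδ, one_mul]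
    rwa [div_lt_iff₀ hn] at hs
  have hs0 : 0 < s := (by positivity : 0 < δ / n).trans hs
  have hd : 0 < δ - e := by linarith
  set K : ℝ≥0 := Real.toNNReal (2 + √n) with hK
  set r : ℤ × (Fin n → ℤ) → ℝ≥0 := fun P =>
    if IsMaximalCube y k δ e a N P then K * Real.toNNReal (2 ^ P.1) else 0 with hr
  set w : ι → ℝ≥0∞ := fun i => if N < ⨆ m, cubeScore δ e a y k m (y i) then
          N ^ ((1 - 1 / a) - 1) *
            (⨆ m, cubeScore δ e a y k m (y i)) ^ (-(1 - 1 / a)) else 0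
  have hcover : denseSet e s A N ⊆ ⋃ P, ball (dyadicCorner P.1 P.2) (r P) := by
    rintro x ⟨m, v, hxv, hNv⟩
    obtain ⟨m', hm', hsc⟩ := exists_le_cubeScore y k hδ hδn he hs0 hcov m v
    obtain ⟨M, hM, hmax⟩ := exists_isMaximalCube (y := y) (k := k) hδ heδ ha.le hfin
      (pos_iff_ne_zero.2 hN0) (hNv.trans_le hsc)
    refine mem_iUnion.2 ⟨(M, dyadicIndex M v), ?_⟩
    have hL : (0 : ℝ) < 2 ^ M := by positivity
    have h1 : dist x v ≤ 2 ^ M := hxv.trans (zpow_le_zpow_right₀ one_le_two (hm'.trans hM))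
    have h2 : dist v (dyadicCorner M (dyadicIndex M v)) ≤ √n * 2 ^ M :=
      norm_sub_le_of_dyadicIndex_eq (dyadicIndex_corner M _).symm
    rw [mem_ball]
    simp only [hr, if_pos hmax]
    have h3 := dist_triangle x v (dyadicCorner M (dyadicIndex M v))
    have h4 : ((K * Real.toNNReal (2 ^ M) : ℝ≥0) : ℝ) = (2 + √n) * 2 ^ M := by
      rw [NNReal.coe_mul, hK, Real.coe_toNNReal _ (by positivity),
        Real.coe_toNNReal _ (by positivity)]
    rw [h4]
    nlinarith
  calc hContent n (δ - e) (denseSet e s A N) ≤ ∑' P, (r P : ℝ≥0∞) ^ (δ - e) :=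
        hContent_le_tsum_of_cover hd _ r hcover
    _ ≤ ∑' P : ℤ × (Fin n → ℤ), ∑' i, ENNReal.ofReal (2 + √n) ^ (δ - e) *
          (if IsMaximalCube y k δ e a N P ∧ dyadicIndex P.1 (y i) = P.2 then
            2 ^ ((k i : ℝ) * δ) * w i else 0) := by
        refine ENNReal.tsum_le_tsum fun P => ?_
        by_cases hP : IsMaximalCube y k δ e a N P
        · have hr' : (r P : ℝ≥0∞) ^ (δ - e)
              = ENNReal.ofReal (2 + √n) ^ (δ - e) * 2 ^ ((P.1 : ℝ) * (δ - e)) := by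
            have : (r P : ℝ≥0∞) = ENNReal.ofReal (2 + √n) * 2 ^ (P.1 : ℝ) := by
              simp only [hr, if_pos hP]
              rw [← ofReal_two_zpow, ENNReal.coe_mul]
              rfl
            rw [this, ENNReal.mul_rpow_of_nonneg _ _ hd.le, ← ENNReal.rpow_mul]
          rw [hr', ENNReal.tsum_mul_left]
          refine mul_le_mul_right ?_ _
          have hNle : N ≤ 2 ^ ((P.1 : ℝ) * e) *
              (cubeMass δ y k P.1 (dyadicCorner P.1 P.2) / 2 ^ ((P.1 : ℝ) * δ)) ^ a := by
            refine hP.1.le.trans ?_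
            unfold cubeScore
            gcongr
            exact min_le_right _ _
          have hsup : ∀ i, dyadicIndex P.1 (y i) = P.2 →
              (⨆ m, cubeScore δ e a y k m (y i)) ≤ 2 ^ ((P.1 : ℝ) * e) := fun i hi =>
            hP.iSup_score_le he (by linarith) hi
          have hlt : ∀ i, dyadicIndex P.1 (y i) = P.2 →
              N < ⨆ m, cubeScore δ e a y k m (y i) := fun i hi => by
            refine hP.1.trans_le ?_
            rw [cubeScore_congr y k (w := y i) (by rw [dyadicIndex_corner, hi])]
            exact le_iSup (fun m => cubeScore δ e a y k m (y i)) P.1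
          set T := ⨆ (i) (_ : dyadicIndex P.1 (y i) = P.2), ⨆ m, cubeScore δ e a y k m (y i)
          have hT : T ≤ 2 ^ ((P.1 : ℝ) * e) := iSup₂_le hsup
          refine (side_rpow_le_of_lt_score ha P.1 hN0 hNt hNle hT).trans ?_
          unfold cubeMass
          rw [← ENNReal.tsum_mul_right]
          refine ENNReal.tsum_le_tsum fun i => ?_
          rw [dyadicIndex_corner]
          by_cases hi : dyadicIndex P.1 (y i) = P.2
          · rw [if_pos (show _ ∧ _ from ⟨hP, hi⟩)]
            refine mul_le_mul' (by split_ifs <;> simp) ?_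
            simp only [w, if_pos (hlt i hi)]
            refine mul_le_mul_right ?_ _
            rw [ENNReal.rpow_neg, ENNReal.rpow_neg, ENNReal.inv_le_inv]
            refine ENNReal.rpow_le_rpow ?_ ?_
            · exact le_iSup₂ (f := fun i (_ : dyadicIndex P.1 (y i) = P.2) =>
                ⨆ m, cubeScore δ e a y k m (y i)) i hi
            · rw [sub_nonneg, div_le_one (by linarith)]; exact ha.le
          · rw [if_neg (fun h => hi h.2), zero_mul]
            exact zero_le
        · simp [hr, if_neg hP, hd]
    _ = ∑' i, ∑' P : ℤ × (Fin n → ℤ), ENNReal.ofReal (2 + √n) ^ (δ - e) *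
          (if IsMaximalCube y k δ e a N P ∧ dyadicIndex P.1 (y i) = P.2 then
            2 ^ ((k i : ℝ) * δ) * w i else 0) := ENNReal.tsum_comm
    _ ≤ ∑' i, ENNReal.ofReal (2 + √n) ^ (δ - e) * (2 ^ ((k i : ℝ) * δ) * w i) := by
        refine ENNReal.tsum_le_tsum fun i => ?_
        rw [ENNReal.tsum_mul_left]
        refine mul_le_mul_right ?_ _
        by_cases h : ∃ P, IsMaximalCube y k δ e a N P ∧ dyadicIndex P.1 (y i) = P.2
        · obtain ⟨P, hP, hPi⟩ := h
          rw [tsum_eq_single P]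
          · split_ifs <;> simp
          · intro Q hQ
            rw [if_neg]
            rintro ⟨hQ', hQi⟩
            exact hQ (hQ'.eq_of_mem hP hQi hPi)
        · push Not at h
          rw [ENNReal.tsum_eq_zero.2]
          · exact zero_le
          · intro P
            rw [if_neg]
            rintro ⟨h1, h2⟩
            exact h P h1 h2
    _ = _ := ENNReal.tsum_mul_left

/-- Restricted strong-type estimate for the fractional maximal function with respect to the
Hausdorff content. -/
lemma exists_lintegral_hContent_denseSet_le {n : ℕ} {δ e s : ℝ} (hδ : 0 < δ)
    (hδn : δ ≤ n) (he : 0 ≤ e) (heδ : e < δ) (hs : δ / n < s) :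
    ∃ C : ℝ≥0∞, C ≠ ⊤ ∧ ∀ A : Set (EuclideanSpace ℝ (Fin n)),
      ∫⁻ N in Ioi (0 : ℝ), hContent n (δ - e) (denseSet e s A (ENNReal.ofReal N))
        ≤ C * hContent n δ A := by
  have hn : (0 : ℝ) < n := hδ.trans_le hδn
  set a := s * n / δ with ha_def
  have ha : 1 < a := by
    rw [ha_def, lt_div_iff₀ hδ, one_mul]
    rwa [div_lt_iff₀ hn] at hs
  have hε : 0 < 1 - 1 / a := by
    rw [sub_pos, div_lt_one (by linarith)]; exact ha
  have hd : 0 ≤ δ - e := by linarith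
  have hc1 : ENNReal.ofReal (2 + √n) ^ (δ - e) ≠ ⊤ :=
    ENNReal.rpow_ne_top_of_nonneg hd ENNReal.ofReal_ne_top
  have hc2 : (2 ^ n * 4 ^ δ : ℝ≥0∞) ≠ ⊤ := ENNReal.mul_ne_top (by simp)
    (ENNReal.rpow_ne_top_of_nonneg hδ.le (by simp))
  have hc2' : (2 ^ n * 4 ^ δ : ℝ≥0∞) ≠ 0 := by simp [ENNReal.rpow_eq_zero_iff]
  set C0 := ENNReal.ofReal (2 + √n) ^ (δ - e) * ENNReal.ofReal (1 / (1 - 1 / a)) *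
    (2 ^ n * 4 ^ δ) with hC0
  have hC0t : C0 ≠ ⊤ := ENNReal.mul_ne_top (ENNReal.mul_ne_top hc1 ENNReal.ofReal_ne_top) hc2
  have hC00 : C0 ≠ 0 := by
    refine mul_ne_zero (mul_ne_zero ?_ ?_) hc2'
    · have : 0 < 2 + √n := by positivity
      simp [ENNReal.rpow_eq_zero_iff, this]
    · simpa using hε
  refine ⟨C0, hC0t, fun A => ?_⟩
  conv_rhs => unfold hContent
  simp only [ENNReal.mul_iInf_of_ne hC00 hC0t]
  refine le_iInf fun x => le_iInf fun r => le_iInf fun hcovA => ?_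
  rcases eq_or_ne (∑' i, (r i : ℝ≥0∞) ^ δ) ⊤ with htop | htop
  · rw [htop, ENNReal.mul_top hC00]
    exact le_top
  obtain ⟨ι, hι, y, k, hcov, hsum⟩ := exists_dyadic_cover hδ x r hcovA
  have hfin : ∑' i, (2 : ℝ≥0∞) ^ ((k i : ℝ) * δ) ≠ ⊤ :=
    (hsum.trans_lt (ENNReal.mul_lt_top hc2.lt_top htop.lt_top)).ne
  set T : ι → ℝ≥0∞ := fun i => ⨆ m, cubeScore δ e a y k m (y i)
  set w : ι → ℝ → ℝ≥0∞ := fun i N => if ENNReal.ofReal N < T i then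
    ENNReal.ofReal N ^ ((1 - 1 / a) - 1) * T i ^ (-(1 - 1 / a)) else 0
  have hw : ∀ i, Measurable (w i) := fun i => by
    refine Measurable.ite (measurableSet_lt (by fun_prop) measurable_const) ?_ measurable_const
    fun_prop
  calc _ ≤ ∫⁻ N in Ioi (0 : ℝ), ENNReal.ofReal (2 + √n) ^ (δ - e) *
          ∑' i, 2 ^ ((k i : ℝ) * δ) * w i N := by
        refine setLIntegral_mono' measurableSet_Ioi fun N hN => ?_
        exact hContent_denseSet_le hδ hδn he heδ hs hcov hfin
          (by simpa using hN) ENNReal.ofReal_ne_top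
    _ = ENNReal.ofReal (2 + √n) ^ (δ - e) *
          ∑' i, 2 ^ ((k i : ℝ) * δ) * ∫⁻ N in Ioi (0 : ℝ), w i N := by
        rw [lintegral_const_mul' _ _ hc1,
          lintegral_tsum fun i => ((hw i).const_mul _).aemeasurable]
        congr 1
        refine tsum_congr fun i => ?_
        rw [lintegral_const_mul _ (hw i)]
    _ ≤ ENNReal.ofReal (2 + √n) ^ (δ - e) *
          ∑' i, 2 ^ ((k i : ℝ) * δ) * ENNReal.ofReal (1 / (1 - 1 / a)) := by
        gcongr with i
        exact lintegral_truncated_power_le hε (T i)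
    _ ≤ ENNReal.ofReal (2 + √n) ^ (δ - e) *
          (((2 ^ n * 4 ^ δ) * ∑' i, (r i : ℝ≥0∞) ^ δ) * ENNReal.ofReal (1 / (1 - 1 / a))) := by
        rw [ENNReal.tsum_mul_right]
        gcongr
    _ = _ := by rw [hC0]; ring

lemma dyadicDensity_rpow_mul_le {n : ℕ} {δ : ℝ} (hδ : 0 < δ) (hδn : δ ≤ n)
    (A : Set (EuclideanSpace ℝ (Fin n))) (m : ℤ) (y : EuclideanSpace ℝ (Fin n)) :
    dyadicDensity A m y ^ (δ / n) * 2 ^ ((m : ℝ) * δ)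
      ≤ volume (ball (0 : EuclideanSpace ℝ (Fin n)) 1) ^ (δ / n) * hContent n δ A := by
  have hn : (0 : ℝ) < n := hδ.trans_le hδn
  have hV : volume (ball (0 : EuclideanSpace ℝ (Fin n)) 1) ^ (δ / n) ≠ ⊤ :=
    ENNReal.rpow_ne_top_of_nonneg (by positivity) measure_ball_lt_top.ne
  have hV0 : volume (ball (0 : EuclideanSpace ℝ (Fin n)) 1) ^ (δ / n) ≠ 0 := by
    rw [Ne, ENNReal.rpow_eq_zero_iff]
    have := (measure_ball_pos volume (0 : EuclideanSpace ℝ (Fin n)) one_pos).ne'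
    rintro (h | h)
    · exact this h.1
    · exact measure_ball_lt_top.ne h.1
  have : Nonempty (Fin n) := ⟨⟨0, by exact_mod_cast hn⟩⟩
  unfold hContent
  rw [ENNReal.mul_iInf_of_ne hV0 hV]
  refine le_iInf fun x => ?_
  rw [ENNReal.mul_iInf_of_ne hV0 hV]
  refine le_iInf fun r => ?_
  rw [ENNReal.mul_iInf_of_ne hV0 hV]
  refine le_iInf fun hA => ?_
  have hvol : volume (A ∩ {w | dyadicIndex m w = dyadicIndex m y})
      ≤ volume (ball (0 : EuclideanSpace ℝ (Fin n)) 1) * ∑' i, (r i : ℝ≥0∞) ^ (n : ℝ) := by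
    calc _ ≤ volume (⋃ i, ball (x i) (r i)) := measure_mono (inter_subset_left.trans hA)
      _ ≤ ∑' i, volume (ball (x i) (r i)) := measure_iUnion_le _
      _ = _ := by
        rw [← ENNReal.tsum_mul_left]
        refine tsum_congr fun i => ?_
        rw [Measure.addHaar_ball volume (x i) (r i).coe_nonneg, mul_comm,
          finrank_euclideanSpace_fin, ENNReal.ofReal_pow (r i).coe_nonneg, ENNReal.rpow_natCast]
        congr 2
        exact ENNReal.ofReal_coe_nnreal
  have hsum : (∑' i, (r i : ℝ≥0∞) ^ (n : ℝ)) ^ (δ / n) ≤ ∑' i, (r i : ℝ≥0∞) ^ δ := by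
    have h := ENNReal.tsum_rpow_le (fun i => (r i : ℝ≥0∞) ^ δ) (t := n / δ)
      (by rwa [le_div_iff₀ hδ, one_mul])
    have h2 := ENNReal.rpow_le_rpow h (by positivity : 0 ≤ δ / n)
    rw [← ENNReal.rpow_mul, show (n : ℝ) / δ * (δ / n) = 1 by field_simp, ENNReal.rpow_one] at h2
    simpa only [← ENNReal.rpow_mul, show δ * (n / δ) = n by field_simp] using h2
  have hmn : dyadicDensity A m y ^ (δ / n) * 2 ^ ((m : ℝ) * δ)
      = volume (A ∩ {w | dyadicIndex m w = dyadicIndex m y}) ^ (δ / n) := by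
    unfold dyadicDensity
    rw [show (m : ℝ) * δ = (m : ℝ) * n * (δ / n) by field_simp, ENNReal.rpow_mul _ (_ * _),
      ← ENNReal.mul_rpow_of_nonneg _ _ (by positivity),
      ENNReal.div_mul_cancel (two_rpow_ne_zero _) (two_rpow_ne_top _)]
  rw [hmn]
  calc _ ≤ _ := ENNReal.rpow_le_rpow hvol (by positivity)
    _ ≤ _ := by
      rw [ENNReal.mul_rpow_of_nonneg _ _ (by positivity)]
      gcongr

lemma tsum_hContent_dyadic_level_le {n : ℕ} {δ p : ℝ} (hp : 0 < p)
    (Ω : Set (EuclideanSpace ℝ (Fin n))) (g : EuclideanSpace ℝ (Fin n) → ℝ) :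
    ENNReal.ofReal (1 - 2 ^ (-p)) *
      ∑' k : ℤ, 2 ^ ((k : ℝ) * p) * hContent n δ {x ∈ Ω | (2 : ℝ) ^ k < g x}
      ≤ choquet n δ Ω fun x => g x ^ p := by
  set c : ℤ → ℝ := fun k => (2 : ℝ) ^ ((k : ℝ) * p) with hc
  have hmono : Monotone c := fun k l hkl => by
    refine Real.rpow_le_rpow_of_exponent_le one_le_two ?_
    gcongr
  have hcpos : ∀ k, 0 < c k := fun k => by positivity
  calc _ = ∑' k : ℤ, ENNReal.ofReal (c (k + 1) - c k) *
        hContent n δ {x ∈ Ω | (2 : ℝ) ^ (k + 1) < g x} := by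
        rw [← ENNReal.tsum_mul_left, ← (Equiv.addRight (1 : ℤ)).tsum_eq]
        refine tsum_congr fun k => ?_
        simp only [Equiv.coe_addRight]
        rw [← mul_assoc]
        congr 1
        have h1 : c (k + 1) - c k = (1 - 2 ^ (-p)) * c (k + 1) := by
          have : c k = 2 ^ (-p) * c (k + 1) := by
            simp only [hc]
            rw [← Real.rpow_add two_pos]
            congr 1
            push_cast
            ring
          rw [this]; ring
        rw [h1, ENNReal.ofReal_mul]
        · congr 1
          simp only [hc]
          rw [← ENNReal.ofReal_rpow_of_pos two_pos, ENNReal.ofReal_ofNat]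
        · rw [sub_nonneg]
          exact Real.rpow_le_one_of_one_le_of_nonpos one_le_two (by linarith)
    _ ≤ ∑' k : ℤ, ∫⁻ t in Ioc (c k) (c (k + 1)), hContent n δ {x ∈ Ω | t < g x ^ p} := by
        refine ENNReal.tsum_le_tsum fun k => ?_
        rw [mul_comm, ← Real.volume_Ioc, ← setLIntegral_const]
        refine setLIntegral_mono' measurableSet_Ioc fun t ht => hContent_mono fun x hx => ?_
        refine ⟨hx.1, ht.2.trans_lt ?_⟩
        have := Real.rpow_lt_rpow (by positivity) hx.2 hp
        refine lt_of_eq_of_lt ?_ this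
        simp only [hc]
        rw [Real.rpow_mul (by norm_num), Real.rpow_intCast]
    _ = ∫⁻ t in ⋃ k : ℤ, Ioc (c k) (c (k + 1)), hContent n δ {x ∈ Ω | t < g x ^ p} :=
        (lintegral_iUnion (fun _ => measurableSet_Ioc)
          hmono.pairwise_disjoint_on_Ioc_succ _).symm
    _ ≤ _ := lintegral_mono_set (iUnion_subset fun k t ht => (hcpos k).trans ht.1)

lemma ofReal_le_dyadic_levels (k₀ : ℤ) (a : ℝ) :
    ENNReal.ofReal a ≤ 2 ^ (k₀ : ℝ) +
      ∑' i : ℕ, (if (2 : ℝ) ^ (k₀ + i) < a then 2 * 2 ^ ((k₀ : ℝ) + i) else 0) := by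
  rcases le_or_gt a (2 ^ k₀) with h | h
  · refine le_add_right ?_
    rw [← ofReal_two_zpow]
    exact ENNReal.ofReal_le_ofReal h
  · have ha : 0 < a := (by positivity : (0 : ℝ) < 2 ^ k₀).trans h
    obtain ⟨j, hj, hj'⟩ := exists_mem_Ioc_zpow ha one_lt_two
    have hkj : k₀ ≤ j := by
      have := (zpow_lt_zpow_iff_right₀ (one_lt_two (α := ℝ))).1 (h.trans_le hj')
      omega
    obtain ⟨i, rfl⟩ := Int.le.dest hkj
    refine le_add_left ?_
    refine le_trans ?_ (ENNReal.le_tsum i)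
    rw [if_pos hj]
    have : (2 : ℝ≥0∞) * 2 ^ ((k₀ : ℝ) + i) = ENNReal.ofReal (2 ^ (k₀ + i + 1)) := by
      rw [ofReal_two_zpow]
      push_cast
      rw [two_rpow_add _ 1, ENNReal.rpow_one, mul_comm]
    rw [this]
    exact ENNReal.ofReal_le_ofReal hj'

lemma tsum_two_rpow_neg_ne_top {t : ℝ} (ht : 0 < t) :
    ∑' i : ℕ, (2 : ℝ≥0∞) ^ (-(i * t)) ≠ ⊤ := by
  have : ∀ i : ℕ, (2 : ℝ≥0∞) ^ (-(i * t)) = ((2 : ℝ≥0∞) ^ (-t)) ^ i := fun i => by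
    rw [← ENNReal.rpow_natCast, ← ENNReal.rpow_mul]
    congr 1
    ring
  simp_rw [this]
  rw [ENNReal.tsum_geometric, Ne, ENNReal.inv_eq_top, tsub_eq_zero_iff_le, not_le]
  exact ENNReal.rpow_lt_one_of_one_lt_of_neg ENNReal.one_lt_two (by linarith)

lemma exists_lintegral_dyadicCube_le (n : ℕ) {s p : ℝ} (hs : 0 < s) (hsp : s < p) :
    ∃ C : ℝ≥0∞, C ≠ ⊤ ∧ ∀ f : EuclideanSpace ℝ (Fin n) → ℝ, Measurable f →
      ∀ (m : ℤ) (y : EuclideanSpace ℝ (Fin n)) (M : ℝ), 0 < M →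
      (∀ k : ℤ, 2 ^ ((k : ℝ) * p) * dyadicDensity {x | (2 : ℝ) ^ k < f x} m y ^ s
        ≤ ENNReal.ofReal M ^ p) →
      ∫⁻ w in {w | dyadicIndex m w = dyadicIndex m y}, ENNReal.ofReal (f w)
        ≤ C * 2 ^ ((m : ℝ) * n) * ENNReal.ofReal M := by
  have hp : 0 < p := hs.trans hsp
  set b := p / s with hb
  have hb1 : 0 < b - 1 := by
    rw [sub_pos, hb, lt_div_iff₀ hs, one_mul]; exact hsp
  refine ⟨1 + 2 * 2 ^ b * ∑' i : ℕ, (2 : ℝ≥0∞) ^ (-(i * (b - 1))), ?_, ?_⟩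
  · exact ENNReal.add_ne_top.2 ⟨ENNReal.one_ne_top, ENNReal.mul_ne_top
      (ENNReal.mul_ne_top ENNReal.ofNat_ne_top (two_rpow_ne_top _))
      (tsum_two_rpow_neg_ne_top hb1)⟩
  intro f hf m y M hM h
  obtain ⟨k₀, hk, hk'⟩ := exists_mem_Ico_zpow hM one_lt_two
  set Q := {w | dyadicIndex m w = dyadicIndex m y}
  have hdens : ∀ k : ℤ, volume ({x | (2 : ℝ) ^ k < f x} ∩ Q)
      ≤ 2 ^ ((m : ℝ) * n) * (2 ^ (((k₀ : ℝ) + 1) * b) * 2 ^ (-(k * b))) := by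
    intro k
    have h1 : dyadicDensity {x | (2 : ℝ) ^ k < f x} m y ≤
        2 ^ (((k₀ : ℝ) + 1) * b) * 2 ^ (-(k * b)) := by
      have hM2 : ENNReal.ofReal M ≤ 2 ^ ((k₀ : ℝ) + 1) := by
        have := ENNReal.ofReal_le_ofReal hk'.le
        rw [ofReal_two_zpow] at this
        exact_mod_cast this
      have h2 : dyadicDensity {x | (2 : ℝ) ^ k < f x} m y ^ s ≤
          2 ^ (((k₀ : ℝ) + 1) * p) * 2 ^ (-(k * p)) := by
        rw [ENNReal.rpow_neg, ← div_eq_mul_inv,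
          ENNReal.le_div_iff_mul_le (Or.inl (two_rpow_ne_zero _)) (Or.inl (two_rpow_ne_top _)),
          mul_comm, ENNReal.rpow_mul _ (_ + _)]
        exact (h k).trans (ENNReal.rpow_le_rpow hM2 hp.le)
      have h3 := ENNReal.rpow_le_rpow h2 (by positivity : 0 ≤ 1 / s)
      rw [← ENNReal.rpow_mul, mul_one_div_cancel hs.ne', ENNReal.rpow_one,
        ENNReal.mul_rpow_of_nonneg _ _ (by positivity), ← ENNReal.rpow_mul,
        ← ENNReal.rpow_mul] at h3
      refine h3.trans_eq ?_
      congr 2 <;> rw [hb] <;> ring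
    unfold dyadicDensity at h1
    rwa [ENNReal.div_le_iff (two_rpow_ne_zero _) (two_rpow_ne_top _), mul_comm] at h1
  have hmeas : ∀ k : ℤ, MeasurableSet {x | (2 : ℝ) ^ k < f x} := fun k =>
    measurableSet_lt measurable_const hf
  calc ∫⁻ w in Q, ENNReal.ofReal (f w)
      ≤ ∫⁻ w in Q, (2 ^ (k₀ : ℝ) + ∑' i : ℕ,
          ({x | (2 : ℝ) ^ (k₀ + i) < f x}).indicator
            (fun _ => (2 * 2 ^ ((k₀ : ℝ) + i) : ℝ≥0∞)) w) :=
        lintegral_mono fun w => ofReal_le_dyadic_levels k₀ (f w)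
    _ = 2 ^ (k₀ : ℝ) * volume Q + ∑' i : ℕ,
          2 * 2 ^ ((k₀ : ℝ) + i) * volume ({x | (2 : ℝ) ^ (k₀ + i) < f x} ∩ Q) := by
        rw [lintegral_add_left measurable_const, setLIntegral_const, lintegral_tsum]
        · congr 1
          refine tsum_congr fun i => ?_
          rw [lintegral_indicator_const (hmeas _), Measure.restrict_apply (hmeas _)]
        · exact fun i => (measurable_const.indicator (hmeas _)).aemeasurable
    _ ≤ 2 ^ (k₀ : ℝ) * 2 ^ ((m : ℝ) * n) + ∑' i : ℕ,
          2 * 2 ^ b * 2 ^ ((m : ℝ) * n) * 2 ^ (k₀ : ℝ) * 2 ^ (-(i * (b - 1))) := by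
        refine add_le_add (mul_le_mul_right (volume_dyadicCube_le _ _) _)
          (ENNReal.tsum_le_tsum fun i => ?_)
        · calc _ ≤ (2 : ℝ≥0∞) * 2 ^ ((k₀ : ℝ) + i) * (2 ^ ((m : ℝ) * n) *
                (2 ^ (((k₀ : ℝ) + 1) * b) * 2 ^ (-(((k₀ + i : ℤ) : ℝ) * b)))) := by
                gcongr
                exact hdens _
            _ = (2 : ℝ≥0∞) * 2 ^ ((m : ℝ) * n) *
                  (2 ^ ((k₀ : ℝ) + i) * (2 ^ (((k₀ : ℝ) + 1) * b) *
                    2 ^ (-(((k₀ + i : ℤ) : ℝ) * b)))) := by ring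
            _ = (2 : ℝ≥0∞) * 2 ^ ((m : ℝ) * n) * (2 ^ b * 2 ^ (k₀ : ℝ) * 2 ^ (-(i * (b - 1)))) := by
                simp only [← two_rpow_add]
                congr 2
                push_cast
                ring
            _ = _ := by ring
    _ = (1 + 2 * 2 ^ b * ∑' i : ℕ, (2 : ℝ≥0∞) ^ (-(i * (b - 1)))) *
          2 ^ ((m : ℝ) * n) * 2 ^ (k₀ : ℝ) := by
        rw [ENNReal.tsum_mul_left]
        ring
    _ ≤ _ := by
        gcongr
        rw [← ofReal_two_zpow]
        exact ENNReal.ofReal_le_ofReal hk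

lemma exists_lintegral_ball_le (n : ℕ) {s p τ : ℝ} (hs : 0 < s) (hsp : s < p) (hτ : 0 ≤ τ) :
    ∃ C : ℝ≥0∞, C ≠ ⊤ ∧ ∀ f : EuclideanSpace ℝ (Fin n) → ℝ, Measurable f →
      ∀ (x : EuclideanSpace ℝ (Fin n)) (R M : ℝ), 0 < R → 0 < M →
      (∀ (m : ℤ) (y : EuclideanSpace ℝ (Fin n)) (k : ℤ), dist x y ≤ 2 ^ m →
        2 ^ ((m : ℝ) * (τ * p)) *
          (2 ^ ((k : ℝ) * p) * dyadicDensity {x | (2 : ℝ) ^ k < f x} m y ^ s)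
          ≤ ENNReal.ofReal M ^ p) →
      ∫⁻ w in ball x R, ENNReal.ofReal (f w) ≤ C * ENNReal.ofReal (R ^ n * (M * R ^ (-τ))) := by
  classical
  have hp : 0 < p := hs.trans hsp
  obtain ⟨C, hC, h⟩ := exists_lintegral_dyadicCube_le n hs hsp
  refine ⟨3 ^ n * C * 2 ^ n, by
    exact ENNReal.mul_ne_top (ENNReal.mul_ne_top (by simp) hC) (by simp), ?_⟩
  intro f hf x R M hR hM hden
  obtain ⟨m, hm, hm'⟩ := exists_mem_Ioc_zpow hR one_lt_two
  have hL : (0 : ℝ) < 2 ^ (m + 1) := by positivity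
  set S : Finset (Fin n → ℤ) := Fintype.piFinset fun i =>
    Finset.Icc (dyadicIndex (m + 1) x i - 1) (dyadicIndex (m + 1) x i + 1)
  have hcov : ball x R ⊆ ⋃ z : S, ({w | dyadicIndex (m + 1) w = z} ∩ ball x R) := by
    intro w hw
    refine mem_iUnion.2 ⟨⟨dyadicIndex (m + 1) w, ?_⟩, rfl, hw⟩
    refine Fintype.mem_piFinset.2 fun i => Finset.mem_Icc.2 ?_
    have h1 : |w i - x i| < 2 ^ (m + 1) := by
      have := EuclideanSpace.norm_eq (w - x)
      have h2 : ‖(w - x) i‖ ≤ ‖w - x‖ := PiLp.norm_apply_le (w - x) i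
      rw [← dist_eq_norm] at h2
      exact (h2.trans_lt (mem_ball.1 hw)).trans_le hm'
    rw [abs_lt] at h1
    unfold dyadicIndex
    have e1 : w i / 2 ^ (m + 1) < x i / 2 ^ (m + 1) + 1 := by
      rw [div_add_one hL.ne']
      exact div_lt_div_of_pos_right (by linarith) hL
    have e2 : x i / 2 ^ (m + 1) < w i / 2 ^ (m + 1) + 1 := by
      rw [div_add_one hL.ne']
      exact div_lt_div_of_pos_right (by linarith) hL
    have e3 := Int.floor_le_floor e1.le
    have e4 := Int.floor_le_floor e2.le
    rw [Int.floor_add_one] at e3 e4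
    constructor <;> linarith
  set B : ℝ≥0∞ := C * 2 ^ (((m + 1 : ℤ) : ℝ) * n) *
    ENNReal.ofReal (M * ((2 : ℝ) ^ (m + 1)) ^ (-τ))
  have hcube : ∀ z : Fin n → ℤ,
      ∫⁻ w in {w | dyadicIndex (m + 1) w = z} ∩ ball x R, ENNReal.ofReal (f w) ≤ B := by
    intro z
    by_cases hz : ({w | dyadicIndex (m + 1) w = z} ∩ ball x R).Nonempty
    · obtain ⟨y, hy, hyx⟩ := hz
      refine (lintegral_mono_set inter_subset_left).trans ?_
      rw [← hy]
      refine h f hf (m + 1) y _ (by positivity) fun k => ?_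
      have hd : dist x y ≤ 2 ^ (m + 1) := by
        rw [dist_comm]; exact (mem_ball.1 hyx).le.trans hm'
      have := hden (m + 1) y k hd
      rw [ENNReal.ofReal_mul hM.le, ENNReal.mul_rpow_of_nonneg _ _ hp.le,
        ← ENNReal.ofReal_rpow_of_pos hL, ofReal_two_zpow, ← ENNReal.rpow_mul, ← ENNReal.rpow_mul,
        show ((m + 1 : ℤ) : ℝ) * (-τ * p) = -(((m + 1 : ℤ) : ℝ) * (τ * p)) by ring,
        ENNReal.rpow_neg, ← div_eq_mul_inv,
        ENNReal.le_div_iff_mul_le (Or.inl (two_rpow_ne_zero _)) (Or.inl (two_rpow_ne_top _)),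
        mul_comm]
      exact this
    · rw [not_nonempty_iff_eq_empty.1 hz]
      simp
  calc ∫⁻ w in ball x R, ENNReal.ofReal (f w)
      ≤ ∫⁻ w in ⋃ z : S, ({w | dyadicIndex (m + 1) w = z} ∩ ball x R), ENNReal.ofReal (f w) :=
        lintegral_mono_set hcov
    _ ≤ ∑' z : S, ∫⁻ w in {w | dyadicIndex (m + 1) w = z} ∩ ball x R, ENNReal.ofReal (f w) :=
        lintegral_iUnion_le _ _
    _ ≤ ∑' _ : S, B := ENNReal.tsum_le_tsum fun z => hcube z
    _ = 3 ^ n * B := by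
        rw [tsum_fintype, Finset.sum_const, nsmul_eq_mul, Finset.card_univ, Fintype.card_coe,
          Fintype.card_piFinset]
        simp [add_assoc]
    _ ≤ _ := by
        have h2 : (2 : ℝ≥0∞) ^ (((m + 1 : ℤ) : ℝ) * n) ≤ 2 ^ n * ENNReal.ofReal (R ^ n) := by
          rw [ENNReal.rpow_mul, ← ofReal_two_zpow, ENNReal.rpow_natCast, ENNReal.ofReal_pow hR.le,
            ← mul_pow]
          gcongr
          rw [← ENNReal.ofReal_ofNat, ← ENNReal.ofReal_mul (by norm_num)]
          refine ENNReal.ofReal_le_ofReal ?_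
          rw [zpow_add_one₀ (by norm_num)]
          linarith
        have h3 : ((2 : ℝ) ^ (m + 1)) ^ (-τ) ≤ R ^ (-τ) :=
          Real.rpow_le_rpow_of_nonpos hR hm' (by linarith)
        rw [ENNReal.ofReal_mul (by positivity)]
        calc _ ≤ 3 ^ n * (C * (2 ^ n * ENNReal.ofReal (R ^ n)) *
              ENNReal.ofReal (M * R ^ (-τ))) := by
              refine mul_le_mul_right ?_ _
              unfold B
              gcongr
          _ = _ := by ring

lemma enorm_sub_le_lintegral_fderiv {E : Type*} [NormedAddCommGroup E] [NormedSpace ℝ E]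
    {Ω : Set E} (hΩ : IsOpen Ω) {u : E → ℝ} (hu : ContDiffOn ℝ 1 u Ω) {a b : E}
    (hab : ∀ s ∈ Icc (0 : ℝ) 1, a + s • (b - a) ∈ Ω) :
    ‖u b - u a‖ₑ ≤ ∫⁻ s in Icc (0 : ℝ) 1, ‖fderiv ℝ u (a + s • (b - a))‖ₑ * ‖b - a‖ₑ := by
  have h1 : ContDiffOn ℝ 1 (fun s : ℝ => u (a + s • (b - a))) (Icc 0 1) :=
    hu.comp (f := fun s : ℝ => a + s • (b - a)) (by fun_prop) hab
  have h2 := enorm_sub_le_lintegral_deriv_of_contDiffOn_Icc h1 zero_le_one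
  simp only [one_smul, zero_smul, add_zero, add_sub_cancel] at h2
  refine h2.trans (setLIntegral_mono' measurableSet_Icc fun s hs => ?_)
  have hd : HasFDerivAt u (fderiv ℝ u (a + s • (b - a))) (a + s • (b - a)) :=
    ((hu.differentiableOn one_ne_zero).differentiableAt (hΩ.mem_nhds (hab s hs))).hasFDerivAt
  have hl : HasDerivAt (fun s : ℝ => a + s • (b - a)) (b - a) s := by
    simpa using ((hasDerivAt_id s).smul_const (b - a)).const_add a
  have hc : HasDerivAt (fun s : ℝ => u (a + s • (b - a)))
      (fderiv ℝ u (a + s • (b - a)) (b - a)) s := hd.comp_hasDerivAt s hl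
  rw [hc.deriv]
  exact ContinuousLinearMap.le_opENorm _ _

lemma lintegral_comp_add_smul {n : ℕ} {g : EuclideanSpace ℝ (Fin n) → ℝ≥0∞} (hg : Measurable g)
    (z : EuclideanSpace ℝ (Fin n)) {ρ : ℝ} (hρ : 0 < ρ) :
    ∫⁻ w, g (z + ρ • w) = ENNReal.ofReal (ρ ^ n)⁻¹ * ∫⁻ w, g w := by
  have h1 : ∫⁻ w, g (z + ρ • w) = ∫⁻ w, g (z + w) ∂(Measure.map (ρ • ·) volume) := by
    rw [lintegral_map (by fun_prop) (by fun_prop)]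
  rw [h1, Measure.map_addHaar_smul _ hρ.ne', lintegral_smul_measure,
    lintegral_add_left_eq_self g z, finrank_euclideanSpace_fin, abs_of_pos (by positivity),
    smul_eq_mul]

lemma enorm_integral_sub_integral_le {n : ℕ} {Ω U : Set (EuclideanSpace ℝ (Fin n))}
    (hΩ : IsOpen Ω) (hU : MeasurableSet U) (hUΩ : U ⊆ Ω) {u : EuclideanSpace ℝ (Fin n) → ℝ}
    (hu : ContDiffOn ℝ 1 u Ω) {z z' : EuclideanSpace ℝ (Fin n)} {ρ ρ' ρ₀ D : ℝ} (hρ₀ : 0 < ρ₀)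
    (hρ : ρ₀ ≤ ρ) (hρ' : ρ₀ ≤ ρ') (hD : ‖z' - z‖ + |ρ' - ρ| ≤ D)
    (h : ∀ s ∈ Icc (0 : ℝ) 1, ∀ w ∈ closedBall (0 : EuclideanSpace ℝ (Fin n)) 1,
      (z + s • (z' - z)) + (ρ + s * (ρ' - ρ)) • w ∈ U) :
    ‖(∫ w in closedBall 0 1, u (z' + ρ' • w)) - ∫ w in closedBall 0 1, u (z + ρ • w)‖ₑ
      ≤ ENNReal.ofReal (D * (ρ₀ ^ n)⁻¹) * ∫⁻ w in U, ‖fderiv ℝ u w‖ₑ := by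
  have hD0 : 0 ≤ D := (by positivity : 0 ≤ ‖z' - z‖ + |ρ' - ρ|).trans hD
  have hint : ∀ (y : EuclideanSpace ℝ (Fin n)) (r : ℝ),
      (∀ w ∈ closedBall (0 : EuclideanSpace ℝ (Fin n)) 1, y + r • w ∈ U) →
      IntegrableOn (fun w => u (y + r • w)) (closedBall 0 1) := fun y r hyr =>
    (hu.continuousOn.comp (f := fun w => y + r • w) (by fun_prop)
      fun w hw => hUΩ (hyr w hw)).integrableOn_compact (isCompact_closedBall _ _)
  have h0 : ∀ w ∈ closedBall (0 : EuclideanSpace ℝ (Fin n)) 1, z + ρ • w ∈ U := fun w hw => by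
    simpa using h 0 (by simp) w hw
  have h1 : ∀ w ∈ closedBall (0 : EuclideanSpace ℝ (Fin n)) 1, z' + ρ' • w ∈ U := fun w hw => by
    simpa using h 1 (by simp) w hw
  rw [← integral_sub (hint _ _ h1) (hint _ _ h0)]
  refine (enorm_integral_le_lintegral_enorm _).trans ?_
  set g : EuclideanSpace ℝ (Fin n) → ℝ≥0∞ := U.indicator fun w => ‖fderiv ℝ u w‖ₑ with hg
  have hgm : Measurable g := (measurable_fderiv ℝ u).enorm.indicator hU
  calc ∫⁻ w in closedBall 0 1, ‖u (z' + ρ' • w) - u (z + ρ • w)‖ₑ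
      ≤ ∫⁻ w in closedBall (0 : EuclideanSpace ℝ (Fin n)) 1, ∫⁻ s in Icc (0 : ℝ) 1,
          g ((z + s • (z' - z)) + (ρ + s * (ρ' - ρ)) • w) * ENNReal.ofReal D := by
        refine setLIntegral_mono' measurableSet_closedBall fun w hw => ?_
        have hseg : ∀ s : ℝ, (z + ρ • w) + s • ((z' + ρ' • w) - (z + ρ • w))
            = (z + s • (z' - z)) + (ρ + s * (ρ' - ρ)) • w := fun s => by
          module
        refine (enorm_sub_le_lintegral_fderiv hΩ hu fun s hs => ?_).trans ?_
        · rw [hseg]; exact hUΩ (h s hs w hw)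
        · refine setLIntegral_mono' measurableSet_Icc fun s hs => ?_
          rw [hseg, hg, indicator_of_mem (h s hs w hw)]
          gcongr
          rw [← ofReal_norm]
          refine ENNReal.ofReal_le_ofReal (le_trans ?_ hD)
          have hw1 : ‖w‖ ≤ 1 := by simpa using hw
          calc ‖z' + ρ' • w - (z + ρ • w)‖ = ‖(z' - z) + (ρ' - ρ) • w‖ := by
                congr 1; module
            _ ≤ ‖z' - z‖ + |ρ' - ρ| * ‖w‖ := (norm_add_le _ _).trans (by rw [norm_smul]; rfl)
            _ ≤ _ := by gcongr; exact mul_le_of_le_one_right (abs_nonneg _) hw1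
    _ = ∫⁻ s in Icc (0 : ℝ) 1, ∫⁻ w in closedBall (0 : EuclideanSpace ℝ (Fin n)) 1,
          g ((z + s • (z' - z)) + (ρ + s * (ρ' - ρ)) • w) * ENNReal.ofReal D := by
        refine lintegral_lintegral_swap (Measurable.aemeasurable ?_)
        refine Measurable.mul_const (hgm.comp (Continuous.measurable ?_)) _
        fun_prop
    _ ≤ ∫⁻ _ in Icc (0 : ℝ) 1, ENNReal.ofReal (ρ₀ ^ n)⁻¹ * (∫⁻ w, g w) * ENNReal.ofReal D := by
        refine setLIntegral_mono' measurableSet_Icc fun s hs => ?_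
        have hs' : ρ₀ ≤ ρ + s * (ρ' - ρ) := by nlinarith [hs.1, hs.2]
        rw [lintegral_mul_const' _ _ ENNReal.ofReal_ne_top]
        gcongr
        refine (setLIntegral_le_lintegral _ _).trans ?_
        rw [lintegral_comp_add_smul hgm _ (hρ₀.trans_le hs')]
        gcongr
    _ = _ := by
        rw [setLIntegral_const, Real.volume_Icc, hg, lintegral_indicator hU,
          ENNReal.ofReal_mul hD0]
        simp
        ring

lemma tendsto_integral_closedBall_add_smul {n : ℕ} {u : EuclideanSpace ℝ (Fin n) → ℝ}
    {x : EuclideanSpace ℝ (Fin n)} (hu : ContinuousAt u x) {z : ℕ → EuclideanSpace ℝ (Fin n)}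
    {ρ : ℕ → ℝ} (hz : Filter.Tendsto z Filter.atTop (nhds x))
    (hρ : Filter.Tendsto ρ Filter.atTop (nhds 0))
    (hint : ∀ i, IntegrableOn (fun w => u (z i + ρ i • w)) (closedBall 0 1)) :
    Filter.Tendsto (fun i => ∫ w in closedBall 0 1, u (z i + ρ i • w)) Filter.atTop
      (nhds (volume.real (closedBall (0 : EuclideanSpace ℝ (Fin n)) 1) * u x)) := by
  set V := volume.real (closedBall (0 : EuclideanSpace ℝ (Fin n)) 1)
  have hV : 0 ≤ V := measureReal_nonneg
  rw [Metric.tendsto_atTop]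
  intro ε hε
  have hε' : 0 < ε / (V + 1) := by positivity
  obtain ⟨r, hr, hur⟩ := Metric.continuousAt_iff.1 hu _ hε'
  have hlim : Filter.Tendsto (fun i => dist (z i) x + |ρ i|) Filter.atTop (nhds 0) := by
    simpa using (tendsto_iff_dist_tendsto_zero.1 hz).add hρ.abs
  obtain ⟨I, hI⟩ := Filter.eventually_atTop.1 (hlim.eventually (gt_mem_nhds hr))
  refine ⟨I, fun i hi => ?_⟩
  have hconst : V * u x = ∫ _ in closedBall (0 : EuclideanSpace ℝ (Fin n)) 1, u x := by
    rw [setIntegral_const, smul_eq_mul]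
  rw [hconst, dist_eq_norm, ← integral_sub (hint i)
    (integrableOn_const measure_closedBall_lt_top.ne)]
  have hb : ∀ w ∈ closedBall (0 : EuclideanSpace ℝ (Fin n)) 1,
      ‖u (z i + ρ i • w) - u x‖ ≤ ε / (V + 1) := fun w hw => by
    rw [← dist_eq_norm]
    refine (hur ?_).le
    refine lt_of_le_of_lt ?_ (hI i hi)
    have hw1 : ‖w‖ ≤ 1 := by simpa using hw
    calc dist (z i + ρ i • w) x ≤ dist (z i + ρ i • w) (z i) + dist (z i) x :=
          dist_triangle _ _ _
      _ ≤ |ρ i| + dist (z i) x := by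
          gcongr
          rw [dist_eq_norm, add_sub_cancel_left, norm_smul]
          exact mul_le_of_le_one_right (abs_nonneg _) hw1
      _ = _ := add_comm _ _
  refine (norm_setIntegral_le_of_norm_le_const measure_closedBall_lt_top hb).trans_lt ?_
  rw [div_mul_eq_mul_div, div_lt_iff₀ (by positivity)]
  change ε * V < _
  nlinarith

lemma ball_infDist_frontier_subset {E : Type*} [NormedAddCommGroup E] [NormedSpace ℝ E]
    [FiniteDimensional ℝ E] {s : Set E} (hs : s ≠ univ) {x : E} (hx : x ∈ s) :
    ball x (infDist x (frontier s)) ⊆ s := by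
  obtain ⟨y, hy, hxy⟩ := exists_mem_frontier_infDist_compl_eq_dist hx hs
  refine (ball_subset_ball ?_).trans ball_infDist_compl_subset
  rw [hxy]
  exact infDist_le_dist_of_mem hy

/-- The John curve of `x`, prolonged by a constant up to the common time `T`. -/
lemma IsJohnDomainWithCenter.exists_curve {n : ℕ} {α β : ℝ}
    {Ω : Set (EuclideanSpace ℝ (Fin n))} {x₀ : EuclideanSpace ℝ (Fin n)}
    (h : IsJohnDomainWithCenter n α β Ω x₀) (hc : 0 < α / β) {T : ℝ}
    (hT : α / β * T = infDist x₀ (frontier Ω)) {x : EuclideanSpace ℝ (Fin n)} (hx : x ∈ Ω) :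
    ∃ γ : ℝ → EuclideanSpace ℝ (Fin n), γ 0 = x ∧ γ T = x₀ ∧
      (∀ t ∈ Icc 0 T, γ t ∈ Ω ∧ α / β * t ≤ infDist (γ t) (frontier Ω)) ∧
      ∀ t ∈ Icc 0 T, ∀ t' ∈ Icc 0 T, dist (γ t) (γ t') ≤ |t - t'| := by
  obtain ⟨L, hL0, -, γ, h0, hL, hΩ, hlip, hdist⟩ := h.2 x hx
  have hLT : L ≤ T := by
    have := hdist L ⟨hL0, le_rfl⟩
    rw [hL, ← hT] at this
    exact le_of_mul_le_mul_left this hc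
  have hmem : ∀ t ∈ Icc 0 T, min t L ∈ Icc 0 L := fun t ht =>
    ⟨le_min ht.1 hL0, min_le_right _ _⟩
  refine ⟨fun t => γ (min t L), by simp [hL0, h0], by simp [hLT, hL],
    fun t ht => ⟨hΩ _ (hmem t ht), ?_⟩,
    fun t ht t' ht' => ?_⟩
  · rcases le_total t L with htL | htL
    · simpa only [min_eq_left htL] using hdist t ⟨ht.1, htL⟩
    · simp only [min_eq_right htL, hL, ← hT]
      exact mul_le_mul_of_nonneg_left ht.2 hc.le
  · have := hlip.dist_le_mul _ (hmem t ht) _ (hmem t' ht')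
    rw [NNReal.coe_one, one_mul, Real.dist_eq] at this
    exact this.trans ((abs_min_sub_min_le_max _ _ _ _).trans (by simp))

lemma exists_enorm_sub_le_tsum (n : ℕ) (hn : 0 < n) {α β : ℝ} (hα : 0 < α) (hαβ : α ≤ β) :
    ∃ C : ℝ≥0∞, C ≠ ⊤ ∧ ∃ l ∈ Ioo (0 : ℝ) 1, ∀ Ω : Set (EuclideanSpace ℝ (Fin n)), IsOpen Ω →
      IsBounded Ω → IsJohnDomain n α β Ω →
      ∀ u : EuclideanSpace ℝ (Fin n) → ℝ, ContDiffOn ℝ 1 u Ω →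
      ∃ b T : ℝ, 0 < T ∧ ∀ x ∈ Ω, ‖u x - b‖ₑ ≤ C * ∑' i : ℕ,
        ENNReal.ofReal ((T * l ^ i) * ((T * l ^ i) ^ n)⁻¹) *
          ∫⁻ w in ball x (2 * (T * l ^ i)) ∩ Ω, ‖fderiv ℝ u w‖ₑ := by
  have hβ : 0 < β := hα.trans_le hαβ
  set c := α / β with hc_def
  have hc : 0 < c := by positivity
  have hc1 : c ≤ 1 := (div_le_one hβ).2 hαβ
  have : Nonempty (Fin n) := ⟨⟨0, hn⟩⟩
  set V := volume.real (closedBall (0 : EuclideanSpace ℝ (Fin n)) 1) with hV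
  have hVpos : 0 < V := ENNReal.toReal_pos (measure_closedBall_pos volume _ one_pos).ne'
    measure_closedBall_lt_top.ne
  set l := 1 - c / 8 with hl
  refine ⟨ENNReal.ofReal (V⁻¹ * ((c / 8) ^ n)⁻¹), ENNReal.ofReal_ne_top, l,
    ⟨by linarith, by linarith⟩, ?_⟩
  have hl0 : 0 < l := by linarith
  have hl1 : l < 1 := by linarith
  intro Ω hΩ hbdd ⟨x₀, hJ⟩ u hu
  have hne : Ω ≠ univ := by
    rintro rfl
    exact NoncompactSpace.noncompact_univ (X := EuclideanSpace ℝ (Fin n))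
      (isCompact_of_isClosed_isBounded isClosed_univ hbdd)
  have hfr : (frontier Ω).Nonempty := by
    obtain ⟨y, hy, -⟩ := exists_mem_frontier_infDist_compl_eq_dist hJ.1 hne
    exact ⟨y, hy⟩
  have hd0 : 0 < infDist x₀ (frontier Ω) := by
    refine (infDist_pos_iff_notMem_closure hfr).1 ?_
    rw [isClosed_frontier.closure_eq, hΩ.frontier_eq]
    exact fun h => h.2 hJ.1
  set T := infDist x₀ (frontier Ω) / c with hT
  have hTpos : 0 < T := by positivity
  have hcT : c * T = infDist x₀ (frontier Ω) := by rw [hT]; field_simp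
  set b := V⁻¹ * ∫ w in closedBall 0 1, u (x₀ + (c * T / 4) • w) with hb
  refine ⟨b, T, hTpos, fun x hx => ?_⟩
  obtain ⟨γ, hγ0, hγT, hγ, hγlip⟩ := hJ.exists_curve hc hcT hx
  set t : ℕ → ℝ := fun i => T * l ^ i with ht
  have htpos : ∀ i, 0 < t i := fun i => by positivity
  have htT : ∀ i, t i ∈ Icc 0 T := fun i =>
    ⟨(htpos i).le, mul_le_of_le_one_right hTpos.le (pow_le_one₀ hl0.le hl1.le)⟩
  have htsucc : ∀ i, t (i + 1) = t i - c / 8 * t i := fun i => by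
    simp only [ht, pow_succ, hl]; ring
  have htlim : Filter.Tendsto t Filter.atTop (nhds 0) := by
    simpa using (tendsto_pow_atTop_nhds_zero_of_lt_one hl0.le hl1).const_mul T
  have hzx : ∀ i, dist (γ (t i)) x ≤ t i := fun i => by
    have := hγlip _ (htT i) 0 ⟨le_rfl, hTpos.le⟩
    rwa [hγ0, sub_zero, abs_of_pos (htpos i)] at this
  have hzz : ∀ i, ‖γ (t (i + 1)) - γ (t i)‖ ≤ c / 8 * t i := fun i => by
    have := hγlip _ (htT (i + 1)) _ (htT i)
    have h2 : t (i + 1) - t i = -(c / 8 * t i) := by rw [htsucc]; ring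
    rwa [dist_eq_norm, h2, abs_neg, abs_of_pos (by have := htpos i; positivity)] at this
  have hsub : ∀ i, ball (γ (t i)) (c * t i) ⊆ Ω := fun i =>
    (ball_subset_ball (hγ _ (htT i)).2).trans
      (ball_infDist_frontier_subset hne (hγ _ (htT i)).1)
  have hgeo : ∀ i, ∀ s ∈ Icc (0 : ℝ) 1, ∀ w ∈ closedBall (0 : EuclideanSpace ℝ (Fin n)) 1,
      (γ (t i) + s • (γ (t (i + 1)) - γ (t i))) +
        (c * t i / 4 + s * (c * t (i + 1) / 4 - c * t i / 4)) • w ∈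
          ball x (2 * t i) ∩ Ω := by
    intro i s hs w hw
    have hti := htpos i
    have hw1 : ‖w‖ ≤ 1 := by simpa using hw
    set q := (γ (t i) + s • (γ (t (i + 1)) - γ (t i))) +
        (c * t i / 4 + s * (c * t (i + 1) / 4 - c * t i / 4)) • w with hq
    have hct : 0 < c * t i := by positivity
    have hr0 : 0 ≤ c * t i / 4 + s * (c * t (i + 1) / 4 - c * t i / 4) := by
      have e : c * t i / 4 + s * (c * t (i + 1) / 4 - c * t i / 4)
        = (1 - s) * (c * t i / 4) + s * (c * t (i + 1) / 4) := by ring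
      rw [e]
      have h1 := htpos (i + 1)
      have h2 : 0 ≤ 1 - s := by linarith [hs.2]
      have h3 := hs.1
      positivity
    have hr1 : c * t i / 4 + s * (c * t (i + 1) / 4 - c * t i / 4) ≤ c * t i / 4 := by
      have : c * t (i + 1) / 4 - c * t i / 4 ≤ 0 := by
        rw [htsucc]; nlinarith
      nlinarith [hs.1]
    have hdist : dist q (γ (t i)) ≤ 3 / 8 * (c * t i) := by
      rw [dist_eq_norm, hq, add_assoc, add_sub_cancel_left]
      calc _ ≤ ‖s • (γ (t (i + 1)) - γ (t i))‖ + _ := norm_add_le _ _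
        _ = s * ‖γ (t (i + 1)) - γ (t i)‖ +
            (c * t i / 4 + s * (c * t (i + 1) / 4 - c * t i / 4)) * ‖w‖ := by
          rw [norm_smul, norm_smul, Real.norm_of_nonneg hs.1, Real.norm_of_nonneg hr0]
        _ ≤ 1 * (c / 8 * t i) + c * t i / 4 * 1 := by
          gcongr
          · exact hs.2
          · exact hzz i
        _ = _ := by ring
    refine ⟨?_, hsub i ?_⟩
    · rw [mem_ball]
      have := dist_triangle q (γ (t i)) x
      have := hzx i
      nlinarith
    · rw [mem_ball]
      linarith
  set Φ : ℕ → ℝ := fun i => ∫ w in closedBall 0 1, u (γ (t i) + (c * t i / 4) • w) with hΦ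
  have hstep : ∀ i, edist (Φ i) (Φ (i + 1)) ≤ ENNReal.ofReal (t i * ((c / 8 * t i) ^ n)⁻¹) *
      ∫⁻ w in ball x (2 * t i) ∩ Ω, ‖fderiv ℝ u w‖ₑ := by
    intro i
    have hti := htpos i
    rw [edist_comm, edist_eq_enorm_sub]
    refine enorm_integral_sub_integral_le hΩ (measurableSet_ball.inter hΩ.measurableSet)
      inter_subset_right hu (by positivity) ?_ ?_ ?_ (hgeo i)
    · nlinarith
    · rw [htsucc]
      nlinarith [mul_le_mul_of_nonneg_right hc1 (by positivity : 0 ≤ c * t i)]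
    · have h2 : c * t (i + 1) / 4 - c * t i / 4 = -(c * (c / 8 * t i) / 4) := by
        rw [htsucc]; ring
      rw [h2, abs_neg, abs_of_pos (by positivity)]
      have := hzz i
      have h3 : c * t i ≤ t i := mul_le_of_le_one_left hti.le hc1
      nlinarith [mul_le_mul_of_nonneg_right hc1 (by positivity : 0 ≤ c * t i)]
  have hlim : Filter.Tendsto Φ Filter.atTop (nhds (V * u x)) := by
    refine tendsto_integral_closedBall_add_smul
      (hu.continuousOn.continuousAt (hΩ.mem_nhds hx)) ?_ ?_ fun i => ?_
    · exact tendsto_iff_dist_tendsto_zero.2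
        (squeeze_zero (fun _ => dist_nonneg) hzx htlim)
    · have := htlim.const_mul (c / 4)
      simpa [div_mul_eq_mul_div] using this
    · refine (hu.continuousOn.comp (f := fun w => γ (t i) + (c * t i / 4) • w) (by fun_prop)
        fun w hw => ?_).integrableOn_compact (isCompact_closedBall _ _)
      simpa using (hgeo i 0 (by simp) w hw).2
  have hmain := edist_le_tsum_of_edist_le_of_tendsto₀ _ hstep hlim
  have hΦ0 : Φ 0 = V * b := by
    simp only [hΦ, hb, ht, pow_zero, mul_one, hγT]
    field_simp
  have heq : ‖u x - b‖ₑ = ENNReal.ofReal V⁻¹ * edist (Φ 0) (V * u x) := by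
    rw [hΦ0, edist_comm, edist_eq_enorm_sub, ← mul_sub, enorm_mul,
      Real.enorm_of_nonneg hVpos.le, ← mul_assoc, ← ENNReal.ofReal_mul (by positivity),
      inv_mul_cancel₀ hVpos.ne', ENNReal.ofReal_one, one_mul]
  rw [heq, ENNReal.ofReal_mul (by positivity), mul_assoc]
  gcongr
  refine hmain.trans_eq ?_
  rw [← ENNReal.tsum_mul_left]
  refine tsum_congr fun i => ?_
  rw [← mul_assoc (ENNReal.ofReal _), ← ENNReal.ofReal_mul (by positivity)]
  congr 2
  rw [mul_pow, mul_inv]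
  ring

lemma exists_tsum_min_rpow_le {l σ η : ℝ} (hl : l ∈ Ioo (0 : ℝ) 1) (hσ : 0 < σ) (hη : 0 < η) :
    ∃ C : ℝ≥0∞, C ≠ ⊤ ∧ ∀ R : ℝ, 0 < R →
      ∑' i : ℕ, ENNReal.ofReal (min ((R * l ^ i) ^ σ) ((R * l ^ i) ^ (-η))) ≤ C := by
  have hl0 := hl.1
  have hgeom : ∀ t : ℝ, 0 < t → ∑' i : ℕ, ENNReal.ofReal ((l ^ (-(i : ℤ))) ^ (-t)) ≠ ⊤ := by
    intro t ht
    have : ∀ i : ℕ, ENNReal.ofReal ((l ^ (-(i : ℤ))) ^ (-t)) = ENNReal.ofReal (l ^ t) ^ i := by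
      intro i
      rw [← ENNReal.ofReal_pow (by positivity), ← Real.rpow_intCast, ← Real.rpow_mul hl0.le,
        ← Real.rpow_natCast, ← Real.rpow_mul hl0.le]
      congr 2
      push_cast
      ring
    simp_rw [this]
    rw [ENNReal.tsum_geometric, Ne, ENNReal.inv_eq_top, tsub_eq_zero_iff_le, not_le,
      ENNReal.ofReal_lt_one]
    exact Real.rpow_lt_one hl0.le hl.2 ht
  refine ⟨_, ENNReal.add_ne_top.2 ⟨hgeom η hη, hgeom σ hσ⟩, fun R hR => ?_⟩
  have hμ : 1 < l⁻¹ := (one_lt_inv₀ hl0).2 hl.2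
  obtain ⟨j, hj, hj'⟩ := exists_mem_Ico_zpow hR hμ
  set g : ℤ → ℝ≥0∞ := fun k =>
    ENNReal.ofReal (min ((l ^ (-(k + 1))) ^ σ) ((l ^ (-k)) ^ (-η))) with hg
  have hterm : ∀ i : ℕ,
      ENNReal.ofReal (min ((R * l ^ i) ^ σ) ((R * l ^ i) ^ (-η))) ≤ g (j - i) := by
    intro i
    have h1 : l ^ (-(j - i : ℤ)) ≤ R * l ^ i := by
      rw [neg_sub, sub_eq_neg_add, zpow_add₀ hl0.ne', zpow_natCast, zpow_neg, ← inv_zpow]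
      gcongr
    have h2 : R * l ^ i ≤ l ^ (-(j - i + 1 : ℤ)) := by
      rw [show -(j - i + 1 : ℤ) = -(j + 1) + i by ring, zpow_add₀ hl0.ne', zpow_natCast,
        zpow_neg, ← inv_zpow]
      gcongr
    refine ENNReal.ofReal_le_ofReal (min_le_min ?_ ?_)
    · exact Real.rpow_le_rpow (by positivity) h2 hσ.le
    · exact Real.rpow_le_rpow_of_nonpos (by positivity) h1 (by linarith)
  calc _ ≤ ∑' i : ℕ, g (j - i) := ENNReal.tsum_le_tsum hterm
    _ ≤ ∑' k : ℤ, g k := ENNReal.tsum_comp_le_tsum_of_injective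
        (f := fun i : ℕ => j - (i : ℤ)) (fun a b h => by simpa using h) g
    _ = ∑' i : ℕ, g i + ∑' i : ℕ, g (-(i + 1 : ℤ)) :=
        tsum_of_nat_of_neg_add_one ENNReal.summable ENNReal.summable
    _ ≤ _ := by
        refine add_le_add (ENNReal.tsum_le_tsum fun i => ?_) (ENNReal.tsum_le_tsum fun i => ?_)
        · exact ENNReal.ofReal_le_ofReal (min_le_right _ _)
        · refine ENNReal.ofReal_le_ofReal ((min_le_left _ _).trans_eq ?_)
          rw [← Real.rpow_intCast, ← Real.rpow_mul hl0.le, ← Real.rpow_intCast,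
            ← Real.rpow_mul hl0.le]
          congr 1
          push_cast
          ring

lemma exists_tsum_min_mul_rpow_le {l σ η : ℝ} (hl : l ∈ Ioo (0 : ℝ) 1) (hσ : 0 < σ)
    (hη : 0 < η) :
    ∃ C : ℝ≥0∞, C ≠ ⊤ ∧ ∀ R X Y : ℝ, 0 < R → 0 < X → 0 < Y →
      ∑' i : ℕ, ENNReal.ofReal (min (X * (R * l ^ i) ^ σ) (Y * (R * l ^ i) ^ (-η)))
        ≤ C * ENNReal.ofReal (X ^ (η / (σ + η)) * Y ^ (σ / (σ + η))) := by
  obtain ⟨C, hC, h⟩ := exists_tsum_min_rpow_le hl hσ hη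
  refine ⟨C, hC, fun R X Y hR hX hY => ?_⟩
  have hl0 := hl.1
  have hση : 0 < σ + η := by positivity
  set Z := X ^ (η / (σ + η)) * Y ^ (σ / (σ + η)) with hZ
  have hZ0 : 0 < Z := by positivity
  set r := (X / Y) ^ (1 / (σ + η)) with hr
  have hr0 : 0 < r := by positivity
  have hX' : X = Z * r ^ σ := by
    rw [hZ, hr, ← Real.rpow_mul (by positivity), Real.div_rpow hX.le hY.le,
      show 1 / (σ + η) * σ = σ / (σ + η) by ring]
    have : X = X ^ (η / (σ + η)) * X ^ (σ / (σ + η)) := by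
      rw [← Real.rpow_add hX, ← add_div, add_comm η, div_self hση.ne', Real.rpow_one]
    field_simp
    exact this
  have hY' : Y = Z * r ^ (-η) := by
    rw [hZ, hr, ← Real.rpow_mul (by positivity), mul_neg, Real.rpow_neg (by positivity),
      Real.div_rpow hX.le hY.le, show 1 / (σ + η) * η = η / (σ + η) by ring]
    have : Y = Y ^ (σ / (σ + η)) * Y ^ (η / (σ + η)) := by
      rw [← Real.rpow_add hY, ← add_div, div_self hση.ne', Real.rpow_one]
    field_simp
    exact this
  have hterm : ∀ i : ℕ, ENNReal.ofReal (min (X * (R * l ^ i) ^ σ) (Y * (R * l ^ i) ^ (-η)))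
      = ENNReal.ofReal Z *
        ENNReal.ofReal (min ((r * R * l ^ i) ^ σ) ((r * R * l ^ i) ^ (-η))) := by
    intro i
    rw [← ENNReal.ofReal_mul hZ0.le, mul_min_of_nonneg _ _ hZ0.le, mul_assoc r,
      Real.mul_rpow hr0.le (by positivity), Real.mul_rpow hr0.le (by positivity), ← mul_assoc,
      ← mul_assoc, ← hX', ← hY']
  simp_rw [hterm]
  rw [ENNReal.tsum_mul_left, mul_comm]
  gcongr
  exact h _ (by positivity)

lemma exists_dyadicDensity_level_le {n : ℕ} {δ p s : ℝ} (hδ : 0 < δ) (hδn : δ ≤ n) (hp : 0 < p)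
    (hs : δ / n ≤ s) :
    ∃ D : ℝ, 0 < D ∧ ∀ (Ω : Set (EuclideanSpace ℝ (Fin n))) (g : EuclideanSpace ℝ (Fin n) → ℝ)
      (m k : ℤ) (y : EuclideanSpace ℝ (Fin n)),
      2 ^ ((m : ℝ) * δ) * (2 ^ ((k : ℝ) * p) * dyadicDensity {x ∈ Ω | (2 : ℝ) ^ k < g x} m y ^ s)
        ≤ ENNReal.ofReal D * choquet n δ Ω fun x => g x ^ p := by
  have hn : (0 : ℝ) < n := hδ.trans_le hδn
  set V := volume (ball (0 : EuclideanSpace ℝ (Fin n)) 1) ^ (δ / n) with hV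
  have hVt : V ≠ ⊤ := ENNReal.rpow_ne_top_of_nonneg (by positivity) measure_ball_lt_top.ne
  have hc : (0 : ℝ) < 1 - 2 ^ (-p) := by
    rw [sub_pos]
    exact Real.rpow_lt_one_of_one_lt_of_neg one_lt_two (by linarith)
  refine ⟨V.toReal / (1 - 2 ^ (-p)) + 1, by positivity, fun Ω g m k y => ?_⟩
  set E := {x ∈ Ω | (2 : ℝ) ^ k < g x}
  have h1 : dyadicDensity E m y ^ s ≤ dyadicDensity E m y ^ (δ / n) :=
    ENNReal.rpow_le_rpow_of_exponent_ge (dyadicDensity_le_one _ _ _) hs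
  have h2 : 2 ^ ((k : ℝ) * p) * hContent n δ E ≤
      (ENNReal.ofReal (1 - 2 ^ (-p)))⁻¹ * choquet n δ Ω fun x => g x ^ p := by
    rw [mul_comm _⁻¹, ← div_eq_mul_inv, ENNReal.le_div_iff_mul_le (Or.inl (by simpa using hc))
      (Or.inl ENNReal.ofReal_ne_top), mul_comm]
    refine le_trans ?_ (tsum_hContent_dyadic_level_le hp Ω g)
    gcongr
    exact ENNReal.le_tsum (f := fun k : ℤ =>
      2 ^ ((k : ℝ) * p) * hContent n δ {x ∈ Ω | (2 : ℝ) ^ k < g x}) k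
  calc _ ≤ 2 ^ ((k : ℝ) * p) * (dyadicDensity E m y ^ (δ / n) * 2 ^ ((m : ℝ) * δ)) := by
        rw [mul_left_comm, mul_comm (2 ^ ((m : ℝ) * δ))]
        gcongr
    _ ≤ 2 ^ ((k : ℝ) * p) * (V * hContent n δ E) :=
        mul_le_mul_right (dyadicDensity_rpow_mul_le hδ hδn E m y) _
    _ = V * (2 ^ ((k : ℝ) * p) * hContent n δ E) := by ring
    _ ≤ V * ((ENNReal.ofReal (1 - 2 ^ (-p)))⁻¹ * choquet n δ Ω fun x => g x ^ p) := by gcongr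
    _ = ENNReal.ofReal (V.toReal / (1 - 2 ^ (-p))) * choquet n δ Ω fun x => g x ^ p := by
        rw [div_eq_mul_inv, ENNReal.ofReal_mul ENNReal.toReal_nonneg, ENNReal.ofReal_toReal hVt,
          ENNReal.ofReal_inv_of_pos hc, mul_assoc]
    _ ≤ _ := by gcongr; linarith

lemma exists_abs_sub_rpow_le {n : ℕ} {α β δ κ p s : ℝ} (hα : 0 < α) (hαβ : α ≤ β) (hδ : 0 < δ)
    (hδn : δ ≤ n) (hκ0 : 0 ≤ κ) (hκ1 : κ < 1) (hs : δ / n ≤ s) (hsp : s < p) (hpδ : p < δ) :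
    ∃ K : ℝ, 0 < K ∧ ∀ Ω : Set (EuclideanSpace ℝ (Fin n)), IsOpen Ω → IsBounded Ω →
      IsJohnDomain n α β Ω → ∀ u : EuclideanSpace ℝ (Fin n) → ℝ, ContDiffOn ℝ 1 u Ω →
      ∃ b : ℝ, ∀ A : ℝ, 0 < A → (choquet n δ Ω fun x => ‖fderiv ℝ u x‖ ^ p) ≤ ENNReal.ofReal A →
      ∀ x ∈ Ω, ∀ N : ℝ, 0 < N →
      (∀ k : ℤ, x ∉ denseSet (κ * p) s {x ∈ Ω | (2 : ℝ) ^ k < ‖fderiv ℝ u x‖}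
        (ENNReal.ofReal (N * 2 ^ (-((k : ℝ) * p))))) →
      |u x - b| ^ (p * (δ - κ * p) / (δ - p)) ≤ K * A ^ (p * (1 - κ) / (δ - p)) * N := by
  have hn : (0 : ℝ) < n := hδ.trans_le hδn
  have hs0 : 0 < s := (by positivity : 0 < δ / n).trans_le hs
  have hp : 0 < p := hs0.trans hsp
  have hδp : 0 < δ - p := by linarith
  have hδκp : 0 < δ - κ * p := by nlinarith
  set q := p * (δ - κ * p) / (δ - p) with hq
  have hq0 : 0 < q := by positivity
  obtain ⟨C₁, hC₁, l, hl, hchain⟩ := exists_enorm_sub_le_tsum n (by exact_mod_cast hn) hα hαβ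
  obtain ⟨C₂, hC₂, hnear⟩ := exists_lintegral_ball_le n (τ := κ) hs0 hsp hκ0
  obtain ⟨C₃, hC₃, hfar⟩ := exists_lintegral_ball_le n (τ := δ / p) hs0 hsp (by positivity)
  obtain ⟨C₄, hC₄, hsum⟩ := exists_tsum_min_mul_rpow_le (σ := 1 - κ) (η := δ / p - 1) hl
    (by linarith) (by rw [sub_pos, lt_div_iff₀ hp]; linarith)
  obtain ⟨D, hD, hdens⟩ := exists_dyadicDensity_level_le (s := s) hδ hδn hp hs
  set C := C₁ * (max C₂ C₃ * ENNReal.ofReal (2 ^ n) * C₄) with hC_def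
  have hC : C ≠ ⊤ := ENNReal.mul_ne_top hC₁ (ENNReal.mul_ne_top
    (ENNReal.mul_ne_top (max_lt hC₂.lt_top hC₃.lt_top).ne ENNReal.ofReal_ne_top) hC₄)
  refine ⟨(C.toReal + 1) ^ q * D ^ (p * (1 - κ) / (δ - p)), by positivity, ?_⟩
  intro Ω hΩ hbdd hJ u hu
  obtain ⟨b, T, hT, hb⟩ := hchain Ω hΩ hbdd hJ u hu
  refine ⟨b, fun A hA hchoq x hx N hN hxN => ?_⟩
  set f : EuclideanSpace ℝ (Fin n) → ℝ := Ω.indicator fun w => ‖fderiv ℝ u w‖ with hf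
  have hfm : Measurable f := (measurable_fderiv ℝ u).norm.indicator hΩ.measurableSet
  have hlev : ∀ k : ℤ, {w | (2 : ℝ) ^ k < f w} = {w ∈ Ω | (2 : ℝ) ^ k < ‖fderiv ℝ u w‖} := by
    intro k
    ext w
    by_cases hw : w ∈ Ω
    · simp [hf, hw]
    · have : (0 : ℝ) ≤ 2 ^ k := by positivity
      simp [hf, hw, this]
  have hint : ∀ r : ℝ, ∫⁻ w in ball x r ∩ Ω, ‖fderiv ℝ u w‖ₑ
      = ∫⁻ w in ball x r, ENNReal.ofReal (f w) := by
    intro r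
    rw [inter_comm, ← setLIntegral_indicator hΩ.measurableSet]
    refine lintegral_congr fun w => ?_
    by_cases hw : w ∈ Ω <;> simp [hf, hw]
  set X := N ^ (1 / p) with hX
  set Y := (D * A) ^ (1 / p) with hY
  have hX0 : 0 < X := by positivity
  have hY0 : 0 < Y := by positivity
  have hXp : ENNReal.ofReal X ^ p = ENNReal.ofReal N := by
    rw [ENNReal.ofReal_rpow_of_pos hX0, hX, ← Real.rpow_mul hN.le, one_div_mul_cancel hp.ne',
      Real.rpow_one]
  have hYp : ENNReal.ofReal Y ^ p = ENNReal.ofReal (D * A) := by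
    rw [ENNReal.ofReal_rpow_of_pos hY0, hY, ← Real.rpow_mul (by positivity),
      one_div_mul_cancel hp.ne', Real.rpow_one]
  have hI₂ : ∀ R : ℝ, 0 < R → ∫⁻ w in ball x R, ENNReal.ofReal (f w)
      ≤ C₂ * ENNReal.ofReal (R ^ n * (X * R ^ (-κ))) := by
    refine fun R hR => hnear f hfm x R X hR hX0 fun m y k hxy => ?_
    rw [hXp, hlev]
    have h1 := hxN k
    simp only [denseSet, mem_ofPred_eq, not_exists, not_and, not_lt] at h1
    have h2 := h1 m y hxy
    rw [ENNReal.ofReal_mul hN.le, ← ENNReal.ofReal_rpow_of_pos two_pos, ENNReal.ofReal_ofNat,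
      ENNReal.rpow_neg, ← div_eq_mul_inv, ENNReal.le_div_iff_mul_le (Or.inl (two_rpow_ne_zero _))
      (Or.inl (two_rpow_ne_top _))] at h2
    refine le_trans (le_of_eq ?_) h2
    ring
  have hI₃ : ∀ R : ℝ, 0 < R → ∫⁻ w in ball x R, ENNReal.ofReal (f w)
      ≤ C₃ * ENNReal.ofReal (R ^ n * (Y * R ^ (-(δ / p)))) := by
    refine fun R hR => hfar f hfm x R Y hR hY0 fun m y k hxy => ?_
    rw [hYp, hlev, div_mul_cancel₀ _ hp.ne', ENNReal.ofReal_mul hD.le]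
    exact (hdens Ω (fun w => ‖fderiv ℝ u w‖) m k y).trans (by gcongr)
  have hl0 := hl.1
  have hcomb : ∀ t M τ : ℝ, 0 < t → 0 < M →
      ENNReal.ofReal (t * (t ^ n)⁻¹) * ENNReal.ofReal ((2 * t) ^ n * (M * (2 * t) ^ (-τ)))
        ≤ ENNReal.ofReal (2 ^ n) * ENNReal.ofReal (M * (2 * t) ^ (1 - τ)) := by
    intro t M τ ht hM
    rw [← ENNReal.ofReal_mul (by positivity), ← ENNReal.ofReal_mul (by positivity)]
    refine ENNReal.ofReal_le_ofReal ?_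
    have h1 : (2 * t) ^ (1 - τ) = 2 * t * (2 * t) ^ (-τ) := by
      rw [sub_eq_add_neg, Real.rpow_add (by positivity), Real.rpow_one]
    rw [h1, mul_pow]
    have h2 : 0 ≤ 2 ^ n * (M * (t * (2 * t) ^ (-τ))) := by positivity
    calc _ = 2 ^ n * (M * (t * (2 * t) ^ (-τ))) := by field_simp
      _ ≤ 2 * (2 ^ n * (M * (t * (2 * t) ^ (-τ)))) := by linarith
      _ = _ := by ring
  have hterm : ∀ i : ℕ, ENNReal.ofReal ((T * l ^ i) * ((T * l ^ i) ^ n)⁻¹) *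
      ∫⁻ w in ball x (2 * (T * l ^ i)) ∩ Ω, ‖fderiv ℝ u w‖ₑ
      ≤ max C₂ C₃ * ENNReal.ofReal (2 ^ n) * ENNReal.ofReal
        (min (X * (2 * T * l ^ i) ^ (1 - κ)) (Y * (2 * T * l ^ i) ^ (-(δ / p - 1)))) := by
    intro i
    have ht : 0 < T * l ^ i := by positivity
    rw [hint, mul_assoc 2 T]
    have h2 := hcomb _ X κ ht hX0
    have h3 := hcomb _ Y (δ / p) ht hY0
    rw [neg_sub]
    rcases min_choice (X * (2 * (T * l ^ i)) ^ (1 - κ)) (Y * (2 * (T * l ^ i)) ^ (1 - δ / p))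
      with h | h
    · rw [h, mul_assoc (max _ _)]
      refine (mul_le_mul_right (hI₂ _ (by positivity)) _).trans ?_
      rw [mul_left_comm]
      exact mul_le_mul' (le_max_left _ _) h2
    · rw [h, mul_assoc (max _ _)]
      refine (mul_le_mul_right (hI₃ _ (by positivity)) _).trans ?_
      rw [mul_left_comm]
      exact mul_le_mul' (le_max_right _ _) h3
  set Z := X ^ ((δ / p - 1) / (1 - κ + (δ / p - 1))) * Y ^ ((1 - κ) / (1 - κ + (δ / p - 1)))
    with hZ
  have hmain : ‖u x - b‖ₑ ≤ C * ENNReal.ofReal Z := by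
    calc _ ≤ _ := hb x hx
      _ ≤ C₁ * (max C₂ C₃ * ENNReal.ofReal (2 ^ n) * (C₄ * ENNReal.ofReal Z)) := by
        gcongr
        refine (ENNReal.tsum_le_tsum hterm).trans ?_
        rw [ENNReal.tsum_mul_left]
        gcongr
        exact hsum (2 * T) X Y (by positivity) hX0 hY0
      _ = _ := by rw [hC_def]; ring
  have habs : |u x - b| ≤ (C.toReal + 1) * Z := by
    have hZ0 : 0 < Z := by positivity
    rw [← ENNReal.ofReal_toReal hC, ← ENNReal.ofReal_mul ENNReal.toReal_nonneg,
      ← ofReal_norm, ENNReal.ofReal_le_ofReal_iff (by positivity)] at hmain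
    rw [← Real.norm_eq_abs]
    nlinarith
  have hZq : Z ^ q = N * (D * A) ^ (p * (1 - κ) / (δ - p)) := by
    have e : 1 - κ + (δ / p - 1) = (δ - κ * p) / p := by field_simp; ring
    have hd : δ - p * κ ≠ 0 := by rw [mul_comm]; exact hδκp.ne'
    have e' : δ / p - 1 = (δ - p) / p := by field_simp
    rw [hZ, hX, hY, e, Real.mul_rpow (by positivity) (by positivity), ← Real.rpow_mul hN.le,
      ← Real.rpow_mul hN.le, ← Real.rpow_mul (by positivity), ← Real.rpow_mul (by positivity)]
    congr 1
    · rw [show 1 / p * ((δ / p - 1) / ((δ - κ * p) / p)) * q = 1 by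
        rw [hq, e']; field_simp, Real.rpow_one]
    · congr 1
      rw [hq]
      field_simp
  calc |u x - b| ^ q ≤ ((C.toReal + 1) * Z) ^ q := by gcongr
    _ = _ := by
      rw [Real.mul_rpow (by positivity) (by positivity), hZq, Real.mul_rpow hD.le hA.le]
      ring

lemma setLIntegral_Ioi_comp_mul_left {F : ℝ → ℝ≥0∞} (hF : Measurable F) {θ : ℝ} (hθ : 0 < θ) :
    ∫⁻ t in Ioi (0 : ℝ), F (θ * t) = ENNReal.ofReal θ⁻¹ * ∫⁻ t in Ioi (0 : ℝ), F t := by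
  have h := Real.map_volume_mul_left hθ.ne'
  have h2 : ∫⁻ t, (Ioi (0 : ℝ)).indicator F t ∂(Measure.map (θ * ·) volume)
      = ∫⁻ t in Ioi (0 : ℝ), F (θ * t) := by
    rw [lintegral_map (hF.indicator measurableSet_Ioi) (measurable_const_mul θ),
      ← lintegral_indicator measurableSet_Ioi]
    refine lintegral_congr fun t => ?_
    simp [indicator, hθ]
  rw [← h2, h, lintegral_smul_measure, lintegral_indicator measurableSet_Ioi, abs_of_pos
    (inv_pos.2 hθ), smul_eq_mul]

lemma exists_choquet_abs_sub_rpow_le {n : ℕ} {α β δ κ p : ℝ} (hα : 0 < α) (hαβ : α ≤ β)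
    (hδ : 0 < δ) (hδn : δ ≤ n) (hκ0 : 0 ≤ κ) (hκ1 : κ < 1) (hp1 : δ / n < p) (hpδ : p < δ) :
    ∃ c : ℝ≥0, 0 < c ∧ ∀ Ω : Set (EuclideanSpace ℝ (Fin n)), IsOpen Ω → IsBounded Ω →
      IsJohnDomain n α β Ω → ∀ u : EuclideanSpace ℝ (Fin n) → ℝ, ContDiffOn ℝ 1 u Ω →
      ∃ b : ℝ, ∀ A : ℝ, 0 < A →
        (choquet n δ Ω fun x => ‖fderiv ℝ u x‖ ^ p) ≤ ENNReal.ofReal A →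
        (choquet n (δ - κ * p) Ω fun x => |u x - b| ^ (p * (δ - κ * p) / (δ - p)))
          ≤ c * ENNReal.ofReal (A ^ ((δ - κ * p) / (δ - p))) := by
  have hn : (0 : ℝ) < n := hδ.trans_le hδn
  have hp : 0 < p := (by positivity : 0 < δ / n).trans hp1
  have hδp : 0 < δ - p := sub_pos.2 hpδ
  have hκp : κ * p < δ := by nlinarith
  set s := (δ / n + p) / 2 with hs
  have hs1 : δ / n < s := by rw [hs]; linarith
  have hs2 : s < p := by rw [hs]; linarith
  obtain ⟨C, hC, hkey⟩ := exists_lintegral_hContent_denseSet_le (s := s) hδ hδn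
    (mul_nonneg hκ0 hp.le) hκp hs1
  obtain ⟨K, hK, hpt⟩ := exists_abs_sub_rpow_le hα hαβ hδ hδn hκ0 hκ1 hs1.le hs2 hpδ
  have hr : (0 : ℝ) < 1 - 2 ^ (-p) := by
    rw [sub_pos]
    exact Real.rpow_lt_one_of_one_lt_of_neg one_lt_two (neg_lt_zero.2 hp)
  refine ⟨K.toNNReal * C.toNNReal * (1 - 2 ^ (-p) : ℝ).toNNReal⁻¹ + 1, by positivity, ?_⟩
  intro Ω hΩ hbdd hJ u hu
  obtain ⟨b, hb⟩ := hpt Ω hΩ hbdd hJ u hu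
  refine ⟨b, fun A hA hchoq => ?_⟩
  set q := p * (δ - κ * p) / (δ - p) with hq
  set d := δ - κ * p with hd
  set E : ℤ → Set (EuclideanSpace ℝ (Fin n)) :=
    fun k => {x ∈ Ω | (2 : ℝ) ^ k < ‖fderiv ℝ u x‖} with hE
  set L := K * A ^ (p * (1 - κ) / (δ - p)) with hL
  have hL0 : 0 < L := by positivity
  set θ : ℤ → ℝ := fun k => L⁻¹ * 2 ^ (-((k : ℝ) * p)) with hθ
  have hθ0 : ∀ k, 0 < θ k := fun k => by positivity
  set F : ℤ → ℝ → ℝ≥0∞ :=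
    fun k t => hContent n d (denseSet (κ * p) s (E k) (ENNReal.ofReal t)) with hF
  have hFm : ∀ k, Measurable (F k) := fun k => Antitone.measurable fun t t' htt' =>
    hContent_mono (denseSet_anti _ _ _ (ENNReal.ofReal_le_ofReal htt'))
  have hcov : ∀ t ∈ Ioi (0 : ℝ), hContent n d {x ∈ Ω | t < |u x - b| ^ q}
      ≤ ∑' k, F k (θ k * t) := by
    intro t ht
    refine (hContent_mono ?_).trans (hContent_iUnion_le (sub_pos.2 hκp) _)
    rintro x ⟨hx, htx⟩
    by_contra hx'
    simp only [mem_iUnion, not_exists] at hx'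
    refine absurd (hb A hA hchoq x hx (L⁻¹ * t) (by have := mem_Ioi.1 ht; positivity) ?_)
      (not_le.2 ?_)
    · intro k
      rw [mul_right_comm]
      exact hx' k
    · rwa [← hL, mul_inv_cancel_left₀ hL0.ne']
  have hexp : A ^ (p * (1 - κ) / (δ - p)) * A = A ^ (d / (δ - p)) := by
    nth_rw 2 [← Real.rpow_one A]
    rw [← Real.rpow_add hA]
    congr 1
    field_simp
    ring
  have hθinv : ∀ k, ENNReal.ofReal (θ k)⁻¹ = ENNReal.ofReal L * 2 ^ ((k : ℝ) * p) := by
    intro k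
    rw [hθ, mul_inv, inv_inv, ENNReal.ofReal_mul hL0.le, ← Real.rpow_neg two_pos.le, neg_neg,
      ← ENNReal.ofReal_rpow_of_pos two_pos, ENNReal.ofReal_ofNat]
  have hsum : ∑' k : ℤ, 2 ^ ((k : ℝ) * p) * hContent n δ (E k)
      ≤ (ENNReal.ofReal (1 - 2 ^ (-p)))⁻¹ * ENNReal.ofReal A := by
    rw [mul_comm, ← div_eq_mul_inv, ENNReal.le_div_iff_mul_le
      (Or.inl (ENNReal.ofReal_pos.2 hr).ne') (Or.inl ENNReal.ofReal_ne_top), mul_comm]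
    exact (tsum_hContent_dyadic_level_le hp Ω _).trans hchoq
  calc choquet n d Ω (fun x => |u x - b| ^ q)
      ≤ ∫⁻ t in Ioi (0 : ℝ), ∑' k, F k (θ k * t) := setLIntegral_mono' measurableSet_Ioi hcov
    _ = ∑' k, ∫⁻ t in Ioi (0 : ℝ), F k (θ k * t) :=
        lintegral_tsum fun k => ((hFm k).comp (measurable_const_mul _)).aemeasurable
    _ = ∑' k : ℤ, ENNReal.ofReal L * 2 ^ ((k : ℝ) * p) * ∫⁻ t in Ioi (0 : ℝ), F k t := by
        congr! 2 with k
        rw [setLIntegral_Ioi_comp_mul_left (hFm k) (hθ0 k), hθinv]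
    _ ≤ ∑' k : ℤ, ENNReal.ofReal L * 2 ^ ((k : ℝ) * p) * (C * hContent n δ (E k)) := by
        gcongr with k
        exact hkey (E k)
    _ = ENNReal.ofReal L * C * ∑' k : ℤ, 2 ^ ((k : ℝ) * p) * hContent n δ (E k) := by
        rw [← ENNReal.tsum_mul_left]
        congr! 2 with k
        ring
    _ ≤ ENNReal.ofReal L * C * ((ENNReal.ofReal (1 - 2 ^ (-p)))⁻¹ * ENNReal.ofReal A) := by
        gcongr
    _ = ENNReal.ofReal K * C * (ENNReal.ofReal (1 - 2 ^ (-p)))⁻¹ *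
          ENNReal.ofReal (A ^ (d / (δ - p))) := by
        rw [← hexp, hL, ENNReal.ofReal_mul hK.le, ENNReal.ofReal_mul (by positivity)]
        ring
    _ ≤ _ := by
        gcongr
        push_cast
        rw [ENNReal.coe_toNNReal hC, ENNReal.coe_inv (Real.toNNReal_pos.2 hr).ne']
        exact le_self_add

/-- Theorem: fractional Poincaré–Sobolev inequality in John domains w.r.t.
Hausdorff contents. For a bounded `(α,β)`-John domain `Ω ⊆ ℝⁿ`, `0 < δ ≤ n`, `0 ≤ κ < 1`,
`δ/n < p < δ`, there is `c = c(n, δ, κ, p, α, β)` with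
`inf_b (∫_Ω |u-b|^{p(δ-κp)/(δ-p)} dH^{δ-κp}_∞)^{(δ-p)/(p(δ-κp))} ≤ c (∫_Ω |∇u|^p dH^δ_∞)^{1/p}`
for all `u ∈ C¹(Ω)`. -/
theorem fractional_poincare_sobolev_john_content (n : ℕ) (hn : 2 ≤ n) (α β δ κ p : ℝ)
    (hα : 0 < α) (hαβ : α ≤ β) (hδ0 : 0 < δ) (hδn : δ ≤ (n : ℝ))
    (hκ0 : 0 ≤ κ) (hκ1 : κ < 1) (hp1 : δ / n < p) (hp2 : p < δ) :
    ∃ c : ℝ≥0, 0 < c ∧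
      ∀ Ω : Set (EuclideanSpace ℝ (Fin n)), IsOpen Ω → IsConnected Ω → IsBounded Ω →
        IsJohnDomain n α β Ω →
        ∀ u : EuclideanSpace ℝ (Fin n) → ℝ, ContDiffOn ℝ 1 u Ω →
          ⨅ b : ℝ,
              (choquet n (δ - κ * p) Ω fun x =>
                  |u x - b| ^ (p * (δ - κ * p) / (δ - p))) ^ ((δ - p) / (p * (δ - κ * p)))
            ≤ c * (choquet n δ Ω fun x => ‖fderiv ℝ u x‖ ^ p) ^ (1 / p) := by
  have hp : 0 < p := (by positivity : 0 ≤ δ / n).trans_lt hp1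
  have hδp : 0 < δ - p := sub_pos.2 hp2
  have hd : 0 < δ - κ * p := by nlinarith
  obtain ⟨c, hc, h⟩ := exists_choquet_abs_sub_rpow_le hα hαβ hδ0 hδn hκ0 hκ1 hp1 hp2
  refine ⟨c ^ ((δ - p) / (p * (δ - κ * p))), by positivity, ?_⟩
  intro Ω hΩ _ hbdd hJ u hu
  obtain ⟨b, hb⟩ := h Ω hΩ hbdd hJ u hu
  refine (iInf_le _ b).trans ?_
  set I := choquet n δ Ω fun x => ‖fderiv ℝ u x‖ ^ p
  have hbound : ∀ A : ℝ≥0, I < A →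
      (choquet n (δ - κ * p) Ω fun x => |u x - b| ^ (p * (δ - κ * p) / (δ - p))) ^
        ((δ - p) / (p * (δ - κ * p)))
      ≤ ↑(c ^ ((δ - p) / (p * (δ - κ * p)))) * (A : ℝ≥0∞) ^ (1 / p) := by
    intro A hIA
    have hA : 0 < A := ENNReal.coe_pos.1 (pos_of_gt hIA)
    have h1 := hb A hA (by simpa using hIA.le)
    refine (ENNReal.rpow_le_rpow h1 (by positivity)).trans (le_of_eq ?_)
    rw [ENNReal.mul_rpow_of_nonneg _ _ (by positivity),
      ENNReal.coe_rpow_of_nonneg _ (by positivity),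
      ← ENNReal.ofReal_rpow_of_pos (by exact_mod_cast hA), ENNReal.ofReal_coe_nnreal,
      ← ENNReal.rpow_mul]
    have hd' : δ - p * κ ≠ 0 := by rw [mul_comm]; exact hd.ne'
    congr 2
    field_simp
  rcases eq_or_ne I ⊤ with hI | hI
  · rw [hI, ENNReal.top_rpow_of_pos (by positivity), ENNReal.mul_top]
    · exact le_top
    · exact ENNReal.coe_ne_zero.2 (by positivity)
  · lift I to ℝ≥0 using hI with I₀
    have hcont : Filter.Tendsto
        (fun A : ℝ≥0 => ↑(c ^ ((δ - p) / (p * (δ - κ * p)))) * (A : ℝ≥0∞) ^ (1 / p))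
        (nhdsWithin I₀ (Ioi I₀))
        (nhds (↑(c ^ ((δ - p) / (p * (δ - κ * p)))) * (I₀ : ℝ≥0∞) ^ (1 / p))) := by
      refine ENNReal.Tendsto.const_mul ?_ (Or.inr ENNReal.coe_ne_top)
      exact ((ENNReal.continuous_rpow_const.comp ENNReal.continuous_coe).tendsto I₀).mono_left
        nhdsWithin_le_nhds
    refine ge_of_tendsto hcont ?_
    filter_upwards [self_mem_nhdsWithin] with A hA
    exact hbound A (ENNReal.coe_lt_coe.2 hA)
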